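/- arXiv:1307.7901 — 2 statements merged into one kernel-verified Lean document; each statement's English description precedes it below -/
import Mathlib

section
/- Itô isomorphism in Hilbert spaces, case 1 < p < 2: Let H be a Hilbert space and 1 < p < 2. In the discrete model of the Poisson stochastic integral with X = H, there exist constants c, C > 0 depending only on p such that c · K ≤ (E max_{1≤m≤n} ‖ ∑_{i=1}^m Ñ_i y_i ‖_H^p)^{1/p} ≤ C · K, where K is the infimum of (E(∑_{i=1}^n λ_i ‖u_i‖_H^2)^{p/2})^{1/p} + (∑_{i=1}^n λ_i E‖v_i‖_H^p)^{1/p} over all decompositions y_i = u_i + v_i (i = 1,...,n) into bounded strongly measurable H-valued random variables. -/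
open MeasureTheory ProbabilityTheory
open scoped ENNReal NNReal

namespace PoissonIto

section


section Scalar

/-- The concave function `x ↦ x ^ q` lies below its tangents. -/
lemma rpow_le_tangent {q x y : ℝ} (hq0 : 0 ≤ q) (hq1 : q ≤ 1) (hx : 0 ≤ x) (hy : 0 < y) :
    x ^ q ≤ y ^ q + q * y ^ (q - 1) * (x - y) := by
  have h := rpow_one_add_le_one_add_mul_self (s := x / y - 1)
    (by have := div_nonneg hx hy.le; linarith) hq0 hq1
  rw [add_sub_cancel, Real.div_rpow hx hy.le, div_le_iff₀ (Real.rpow_pos_of_pos hy q)] at h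
  have e : y ^ q = y ^ (q - 1) * y := by
    rw [← Real.rpow_add_one hy.ne', sub_add_cancel]
  calc x ^ q ≤ (1 + q * (x / y - 1)) * y ^ q := h
    _ = y ^ q + q * y ^ (q - 1) * (x - y) := by
      rw [e]; field_simp

lemma sq_rpow_half {x : ℝ} (hx : 0 ≤ x) (p : ℝ) : (x ^ 2) ^ (p / 2) = x ^ p := by
  rw [← Real.rpow_natCast x 2, ← Real.rpow_mul hx]; congr 1; push_cast; ring

lemma sq_rpow_half_sub_one {x : ℝ} (hx : 0 ≤ x) (p : ℝ) :
    (x ^ 2) ^ (p / 2 - 1) = x ^ (p - 2) := by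
  rw [← sq_rpow_half hx (p - 2)]; congr 1; ring

lemma rpow_eq_rpow_sub_two_mul_sq {x : ℝ} (hx : 0 < x) (p : ℝ) : x ^ p = x ^ (p - 2) * x ^ 2 := by
  rw [← Real.rpow_natCast x 2, ← Real.rpow_add hx]; congr 1; push_cast; ring

variable {p : ℝ}

/-- Comparison of increments of squares and of `p`-th powers. -/
lemma rpow_sub_two_mul_sq_sub_sq_le (hp1 : 1 < p) {x y : ℝ} (hx : 0 < x) (hxy : x ≤ y) :
    y ^ (p - 2) * (y ^ 2 - x ^ 2) ≤ 2 * (y ^ p - x ^ p) := by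
  have hy : 0 < y := hx.trans_le hxy
  have h1 : x ^ p ≤ y ^ (p - 2) * y * x := by
    have e1 : x ^ p = x ^ (p - 1) * x := by rw [← Real.rpow_add_one hx.ne', sub_add_cancel]
    have e2 : y ^ (p - 2) * y = y ^ (p - 1) := by
      rw [← Real.rpow_add_one hy.ne']; congr 1; ring
    rw [e1, e2]
    exact mul_le_mul_of_nonneg_right (Real.rpow_le_rpow hx.le hxy (by linarith)) hx.le
  have h2 := rpow_eq_rpow_sub_two_mul_sq hy p
  have h3 : 0 ≤ y ^ (p - 2) * (y - x) ^ 2 := by positivity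
  nlinarith

/-- Quantitative strict convexity of `x ↦ x ^ p`, normalised at `1`. -/
lemma sq_mul_rpow_mul_sq_le_of_one (hp1 : 1 < p) (hp2 : p < 2) {x : ℝ} (hx : 0 < x) :
    (p - 1) ^ 2 / 2 * (max 1 x) ^ (p - 2) * (x - 1) ^ 2 ≤ x ^ p - 1 - p * (x - 1) := by
  have hm1 : 1 ≤ max 1 x := le_max_left _ _
  by_cases hneg : 0 ≤ 1 + p * (x - 1)
  · have h := rpow_one_add_le_one_add_mul_self (s := x - 1) (by linarith)
      (p := 2 - p) (by linarith) (by linarith)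
    rw [add_sub_cancel] at h
    have hw : 0 < x ^ (p - 2) := by positivity
    have h1 : x ^ (2 - p) * x ^ (p - 2) = 1 := by
      rw [← Real.rpow_add hx]; simp
    have h2 : x ^ p = x ^ (p - 2) * x ^ 2 := rpow_eq_rpow_sub_two_mul_sq hx p
    have h3 : (1 + p * (x - 1)) ≤ x ^ (p - 2) * ((1 + (2 - p) * (x - 1)) * (1 + p * (x - 1))) := by
      calc 1 + p * (x - 1) = x ^ (p - 2) * (x ^ (2 - p) * (1 + p * (x - 1))) := by
            rw [← mul_assoc, mul_comm (x ^ (p - 2)), h1, one_mul]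
        _ ≤ _ := by gcongr
    have h4 : (max 1 x) ^ (p - 2) ≤ x ^ (p - 2) :=
      Real.rpow_le_rpow_of_nonpos hx (le_max_right _ _) (by linarith)
    have h5 : (p - 1) ^ 2 * x ^ (p - 2) * (x - 1) ^ 2 ≤ x ^ p - 1 - p * (x - 1) := by
      rw [h2]; nlinarith
    have h6 : 0 ≤ (p - 1) ^ 2 * x ^ (p - 2) * (x - 1) ^ 2 := by positivity
    calc (p - 1) ^ 2 / 2 * (max 1 x) ^ (p - 2) * (x - 1) ^ 2
        ≤ (p - 1) ^ 2 / 2 * x ^ (p - 2) * (x - 1) ^ 2 := by gcongr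
      _ ≤ _ := by linarith
  · push Not at hneg
    have hx1 : x < 1 := by
      by_contra! h
      nlinarith
    have hm : (max 1 x) = 1 := max_eq_left hx1.le
    have h2 : x ^ 2 ≤ x ^ p := by
      rw [← Real.rpow_natCast x 2]
      exact Real.rpow_le_rpow_of_exponent_ge hx hx1.le (by push_cast; linarith)
    rw [hm, Real.one_rpow]
    have h3 : 1 ≤ p * (1 - x) := by linarith
    nlinarith [mul_nonneg (sub_nonneg.2 hx1.le) (sub_nonneg.2 h3), sq_nonneg (1 - x),
      mul_nonneg hx.le (sub_nonneg.2 hx1.le), mul_nonneg (sub_nonneg.2 hx1.le) (sq_nonneg (p-1)),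
      mul_nonneg (mul_nonneg (sub_nonneg.2 hx1.le) (sub_nonneg.2 h3)) (sub_nonneg.2 hp2.le)]

lemma sq_mul_rpow_mul_sq_le (hp1 : 1 < p) (hp2 : p < 2) {α β M : ℝ} (hα : 0 < α) (hβ : 0 < β)
    (hαM : α ≤ M) (hβM : β ≤ M) :
    (p - 1) ^ 2 / 2 * M ^ (p - 2) * (β - α) ^ 2 ≤ β ^ p - α ^ p - p * α ^ (p - 2) * α * (β - α) := by
  have h := sq_mul_rpow_mul_sq_le_of_one hp1 hp2 (div_pos hβ hα)
  have hαp : 0 < α ^ p := by positivity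
  have e1 : max 1 (β / α) = max α β / α := by
    rw [← max_div_div_right hα.le, div_self hα.ne']
  have hmax : 0 < max α β := lt_max_of_lt_left hα
  rw [e1, Real.div_rpow hmax.le hα.le, Real.div_rpow hβ.le hα.le] at h
  have h2 := mul_le_mul_of_nonneg_right h hαp.le
  have e2 := rpow_eq_rpow_sub_two_mul_sq hα p
  have hw : 0 < α ^ (p - 2) := by positivity
  have e3 : (p - 1) ^ 2 / 2 * (max α β ^ (p - 2) / α ^ (p - 2)) * (β / α - 1) ^ 2 * α ^ p =
      (p - 1) ^ 2 / 2 * (max α β) ^ (p - 2) * (β - α) ^ 2 := by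
    rw [e2]; field_simp
  have e4 : (β ^ p / α ^ p - 1 - p * (β / α - 1)) * α ^ p =
      β ^ p - α ^ p - p * α ^ (p - 2) * α * (β - α) := by
    rw [sub_mul, sub_mul, div_mul_cancel₀ _ hαp.ne', one_mul]
    congr 1
    rw [e2]; field_simp
  rw [e3, e4] at h2
  refine le_trans ?_ h2
  have : M ^ (p - 2) ≤ (max α β) ^ (p - 2) :=
    Real.rpow_le_rpow_of_nonpos hmax (max_le hαM hβM) (by linarith)
  gcongr

/-- Uniform convexity of the `p`-th power of a Hilbert norm. -/
lemma norm_rpow_uniform_convex (hp1 : 1 < p) (hp2 : p < 2) {α β M b t : ℝ} (hα : 0 < α)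
    (hβ : 0 < β) (hαM : α ≤ M) (hβM : β ≤ M) (hb : 0 ≤ b) (ht : |t| ≤ α * b)
    (h : β ^ 2 = α ^ 2 + 2 * t + b ^ 2) :
    α ^ p + p * α ^ (p - 2) * t + (p - 1) ^ 2 / 2 * M ^ (p - 2) * b ^ 2 ≤ β ^ p := by
  have h1 := sq_mul_rpow_mul_sq_le hp1 hp2 hα hβ hαM hβM
  have h2 : M ^ (p - 2) ≤ α ^ (p - 2) :=
    Real.rpow_le_rpow_of_nonpos hα hαM (by linarith)
  have hMp : 0 ≤ M ^ (p - 2) := Real.rpow_nonneg (hα.le.trans hαM) _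
  have h3 : (β - α) ^ 2 ≤ b ^ 2 := by
    obtain ⟨ht1, ht2⟩ := abs_le.1 ht
    have : β ≤ α + b := abs_le_of_sq_le_sq' (by nlinarith) (by linarith) |>.2
    have h5 : |α - b| ≤ β := by
      apply abs_le_of_sq_le_sq _ hβ.le
      nlinarith
    obtain ⟨h6, h7⟩ := abs_le.1 h5
    exact sq_le_sq' (by linarith) (by linarith)
  have h4 : t = (β ^ 2 - α ^ 2 - b ^ 2) / 2 := by linarith
  have h5 : (p - 1) ^ 2 / 2 * M ^ (p - 2) * (b ^ 2 - (β - α) ^ 2) ≤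
      p / 2 * α ^ (p - 2) * (b ^ 2 - (β - α) ^ 2) := by
    apply mul_le_mul_of_nonneg_right _ (by linarith)
    apply mul_le_mul _ h2 hMp (by linarith)
    nlinarith
  rw [h4]
  nlinarith

/-- Smoothness of the `p`-th power of a Hilbert norm. -/
lemma norm_rpow_smooth (hp1 : 1 < p) (hp2 : p < 2) {α β b t : ℝ} (hα : 0 < α)
    (hβ : 0 ≤ β) (hb : 0 ≤ b) (ht : |t| ≤ α * b) (h : β ^ 2 = α ^ 2 + 2 * t + b ^ 2) :
    β ^ p ≤ α ^ p + p * α ^ (p - 2) * t + 6 * min (α ^ (p - 2) * b ^ 2) (b ^ p) := by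
  have h1 : β ^ p ≤ α ^ p + p * α ^ (p - 2) * t + p / 2 * (α ^ (p - 2) * b ^ 2) := by
    have := rpow_le_tangent (q := p / 2) (by linarith) (by linarith) (sq_nonneg β)
      (pow_pos hα 2)
    rw [sq_rpow_half hβ, sq_rpow_half hα.le, sq_rpow_half_sub_one hα.le] at this
    refine this.trans (le_of_eq ?_)
    rw [h]; ring
  have hw : 0 < α ^ (p - 2) := by positivity
  have hA : 0 ≤ α ^ (p - 2) * b ^ 2 := by positivity
  have hB : 0 ≤ b ^ p := by positivity
  rcases le_or_gt b α with hba | hba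
  · have : α ^ (p - 2) * b ^ 2 ≤ b ^ p := by
      rcases hb.eq_or_lt with rfl | hb0
      · simp [Real.rpow_nonneg]
      rw [rpow_eq_rpow_sub_two_mul_sq hb0 p]
      gcongr ?_ * _
      exact Real.rpow_le_rpow_of_nonpos hb0 hba (by linarith)
    rw [min_eq_left this]
    nlinarith
  · have hb0 : 0 < b := hα.trans hba
    obtain ⟨ht1, ht2⟩ := abs_le.1 ht
    have h2 : β ≤ 2 * b := by
      apply abs_le_of_sq_le_sq' _ (by linarith) |>.2
      nlinarith
    have h3 : β ^ p ≤ 4 * b ^ p := by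
      calc β ^ p ≤ (2 * b) ^ p := Real.rpow_le_rpow hβ h2 (by linarith)
        _ = 2 ^ p * b ^ p := Real.mul_rpow (by norm_num) hb
        _ ≤ 2 ^ (2 : ℝ) * b ^ p := by
          gcongr
          norm_num
        _ = 4 * b ^ p := by norm_num
    have h4 : α ^ (p - 2) * α * b ≤ b ^ p := by
      have e : α ^ (p - 2) * α = α ^ (p - 1) := by
        rw [← Real.rpow_add_one hα.ne']; congr 1; ring
      have e1 : b ^ p = b ^ (p - 1) * b := by rw [← Real.rpow_add_one hb0.ne', sub_add_cancel]
      rw [e, e1]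
      gcongr
    have h5 : - (2 * b ^ p) ≤ p * α ^ (p - 2) * t := by
      have : - (α ^ (p - 2) * (α * b)) ≤ α ^ (p - 2) * t := by nlinarith
      nlinarith
    have hαp : 0 ≤ α ^ p := by positivity
    rcases min_cases (α ^ (p - 2) * b ^ 2) (b ^ p) with ⟨hm, -⟩ | ⟨hm, -⟩ <;> rw [hm]
    · nlinarith
    · linarith

/-- Lower bound for an increment of `x ↦ x ^ (p / 2)`. -/
lemma rpow_sub_two_mul_sq_le_increment (hp1 : 1 < p) (hp2 : p < 2) {T S a : ℝ} (hT : 0 ≤ T)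
    (hS : 0 < S) (ha : 0 ≤ a) (haS : a ≤ S) (hTS : T ≤ S ^ 2) :
    p / 4 * (S ^ (p - 2) * a ^ 2) ≤ (T + a ^ 2) ^ (p / 2) - T ^ (p / 2) := by
  rcases ha.eq_or_lt with rfl | ha0
  · simp
  have hpos : 0 < T + a ^ 2 := by positivity
  have h1 := rpow_le_tangent (q := p / 2) (by linarith) (by linarith) hT hpos
  have h2 : (2 * S ^ 2) ^ (p / 2 - 1) ≤ (T + a ^ 2) ^ (p / 2 - 1) := by
    apply Real.rpow_le_rpow_of_nonpos hpos _ (by linarith)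
    nlinarith
  have h3 : (2 * S ^ 2) ^ (p / 2 - 1) = 2 ^ (p / 2 - 1) * S ^ (p - 2) := by
    rw [Real.mul_rpow (by norm_num) (by positivity), sq_rpow_half_sub_one hS.le]
  have h4 : (1 / 2 : ℝ) ≤ 2 ^ (p / 2 - 1) := by
    calc (1 / 2 : ℝ) = 2 ^ (-1 : ℝ) := by rw [Real.rpow_neg_one]; norm_num
      _ ≤ _ := Real.rpow_le_rpow_of_exponent_le (by norm_num) (by linarith)
  have h5 : 1 / 2 * S ^ (p - 2) ≤ (T + a ^ 2) ^ (p / 2 - 1) := by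
    refine le_trans ?_ (h3 ▸ h2)
    gcongr
  have h6 : p / 2 * (1 / 2 * S ^ (p - 2)) * a ^ 2 ≤ p / 2 * (T + a ^ 2) ^ (p / 2 - 1) * a ^ 2 := by
    gcongr
  nlinarith

end Scalar

end

section


section Gauge

/-- A recursively defined, monotone functional of the sequence `a` that is equivalent, up to `ε`,
to the norm of `a` in the sum of the weighted spaces `ℓ²` and `ℓᵖ` with weights `l`. -/
noncomputable def gauge (p ε : ℝ) (l a : ℕ → ℝ) : ℕ → ℝ
  | 0 => ε
  | i + 1 => min √(gauge p ε l a i ^ 2 + l i * a i ^ 2)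
      ((gauge p ε l a i ^ p + l i * a i ^ p) ^ (1 / p))

variable {p ε : ℝ} {l a : ℕ → ℝ}

lemma gauge_pos (hε : 0 < ε) (hl : ∀ i, 0 ≤ l i) (ha : ∀ i, 0 ≤ a i) (n : ℕ) :
    0 < gauge p ε l a n := by
  induction n with
  | zero => simpa [gauge]
  | succ i ih =>
    have h1 := hl i
    have h2 := ha i
    rw [gauge]
    apply lt_min
    · positivity
    · positivity

lemma gauge_le_succ (hp : 0 < p) (hε : 0 < ε) (hl : ∀ i, 0 ≤ l i) (ha : ∀ i, 0 ≤ a i) (i : ℕ) :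
    gauge p ε l a i ≤ gauge p ε l a (i + 1) := by
  have hg := gauge_pos (p := p) hε hl ha i
  have h1 := hl i
  have h2 := ha i
  rw [gauge]
  apply le_min
  · apply Real.le_sqrt_of_sq_le
    nlinarith [mul_nonneg h1 (sq_nonneg (a i))]
  · calc gauge p ε l a i = (gauge p ε l a i ^ p) ^ (1 / p) := by
          rw [← Real.rpow_mul hg.le, mul_one_div_cancel hp.ne', Real.rpow_one]
      _ ≤ _ := by
          gcongr
          exact le_add_of_nonneg_right (by positivity)

lemma gauge_mono (hp : 0 < p) (hε : 0 < ε) (hl : ∀ i, 0 ≤ l i) (ha : ∀ i, 0 ≤ a i) :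
    Monotone (gauge p ε l a) :=
  monotone_nat_of_le_succ (gauge_le_succ hp hε hl ha)

lemma le_gauge (hp : 0 < p) (hε : 0 < ε) (hl : ∀ i, 0 ≤ l i) (ha : ∀ i, 0 ≤ a i) (n : ℕ) :
    ε ≤ gauge p ε l a n :=
  gauge_mono hp hε hl ha (Nat.zero_le n)

lemma sq_sqrt_rpow_inv_aux (hp : 0 < p) (hε : 0 < ε) (hl : ∀ i, 0 ≤ l i) (ha : ∀ i, 0 ≤ a i)
    (i : ℕ) :
    √(gauge p ε l a i ^ 2 + l i * a i ^ 2) ^ 2 = gauge p ε l a i ^ 2 + l i * a i ^ 2 ∧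
    ((gauge p ε l a i ^ p + l i * a i ^ p) ^ (1 / p)) ^ p =
      gauge p ε l a i ^ p + l i * a i ^ p := by
  have hg := gauge_pos (p := p) hε hl ha i
  have h1 := hl i
  have h2 := ha i
  refine ⟨Real.sq_sqrt (by positivity), ?_⟩
  rw [← Real.rpow_mul (by positivity), one_div_mul_cancel hp.ne', Real.rpow_one]

lemma gauge_succ_sq_le (hp : 0 < p) (hε : 0 < ε) (hl : ∀ i, 0 ≤ l i) (ha : ∀ i, 0 ≤ a i)
    (i : ℕ) : gauge p ε l a (i + 1) ^ 2 ≤ gauge p ε l a i ^ 2 + l i * a i ^ 2 := by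
  rw [← (sq_sqrt_rpow_inv_aux hp hε hl ha i).1]
  have := (gauge_pos (p := p) hε hl ha (i + 1)).le
  gcongr
  rw [gauge]
  exact min_le_left _ _

lemma gauge_succ_rpow_le (hp : 0 < p) (hε : 0 < ε) (hl : ∀ i, 0 ≤ l i) (ha : ∀ i, 0 ≤ a i)
    (i : ℕ) : gauge p ε l a (i + 1) ^ p ≤ gauge p ε l a i ^ p + l i * a i ^ p := by
  rw [← (sq_sqrt_rpow_inv_aux hp hε hl ha i).2]
  have := (gauge_pos (p := p) hε hl ha (i + 1)).le
  gcongr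
  rw [gauge]
  exact min_le_right _ _

lemma gauge_succ_eq_or (hp : 0 < p) (hε : 0 < ε) (hl : ∀ i, 0 ≤ l i) (ha : ∀ i, 0 ≤ a i)
    (i : ℕ) : gauge p ε l a i ^ 2 + l i * a i ^ 2 = gauge p ε l a (i + 1) ^ 2 ∨
      gauge p ε l a i ^ p + l i * a i ^ p = gauge p ε l a (i + 1) ^ p := by
  obtain ⟨h1, h2⟩ := sq_sqrt_rpow_inv_aux hp hε hl ha i
  rcases min_choice √(gauge p ε l a i ^ 2 + l i * a i ^ 2)
      ((gauge p ε l a i ^ p + l i * a i ^ p) ^ (1 / p)) with h | h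
  · left; rw [gauge.eq_2 p ε l a i, h, h1]
  · right; rw [gauge.eq_2 p ε l a i, h, h2]

lemma mul_min_le_gauge_increment (hp1 : 1 < p) (hε : 0 < ε) (hl : ∀ i, 0 ≤ l i)
    (ha : ∀ i, 0 ≤ a i) (i : ℕ) :
    l i * min (gauge p ε l a (i + 1) ^ (p - 2) * a i ^ 2) (a i ^ p) ≤
      2 * (gauge p ε l a (i + 1) ^ p - gauge p ε l a i ^ p) := by
  have hp : 0 < p := by linarith
  have hg := gauge_pos (p := p) hε hl ha i
  have hle := gauge_le_succ hp hε hl ha i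
  rcases gauge_succ_eq_or hp hε hl ha i with h | h
  · have h1 := rpow_sub_two_mul_sq_sub_sq_le hp1 hg hle
    rw [← h] at h1
    calc _ ≤ l i * (gauge p ε l a (i + 1) ^ (p - 2) * a i ^ 2) :=
          mul_le_mul_of_nonneg_left (min_le_left _ _) (hl i)
      _ ≤ _ := by refine le_trans (le_of_eq ?_) h1; ring
  · have h0 : gauge p ε l a i ^ p ≤ gauge p ε l a (i + 1) ^ p := by gcongr
    calc _ ≤ l i * a i ^ p := mul_le_mul_of_nonneg_left (min_le_right _ _) (hl i)
      _ ≤ _ := by linarith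

/-- The functional `gauge` is dominated by the norm of any decomposition. -/
lemma gauge_rpow_le_of_le_add (hp1 : 1 < p) (hp2 : p < 2) (hε : 0 < ε) (hl : ∀ i, 0 ≤ l i)
    (ha : ∀ i, 0 ≤ a i) {u v : ℕ → ℝ} (hu : ∀ i, 0 ≤ u i) (hv : ∀ i, 0 ≤ v i) (n : ℕ)
    (huv : ∀ i < n, a i ≤ u i + v i) :
    gauge p ε l a n ^ p ≤ 2 * ε ^ p + 8 * (∑ i ∈ Finset.range n, l i * u i ^ 2) ^ (p / 2) +
      16 * ∑ i ∈ Finset.range n, l i * v i ^ p := by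
  have hp : 0 < p := by linarith
  set G := gauge p ε l a n with hG
  have hGpos : 0 < G := gauge_pos hε hl ha n
  have key : ∀ m ≤ n, gauge p ε l a m ^ 2 ≤ ε ^ 2 + 4 * (∑ i ∈ Finset.range m, l i * u i ^ 2) +
      8 * G ^ (2 - p) * ∑ i ∈ Finset.range m, l i * v i ^ p := by
    intro m
    induction m with
    | zero => intro _; simp [gauge]
    | succ i ih =>
      intro hi
      have ih' := ih (by omega)
      rw [Finset.sum_range_succ, Finset.sum_range_succ]
      have hli := hl i
      have hui := hu i
      have hvi := hv i
      have hai := ha i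
      have haa := huv i (by omega)
      have hGp : 0 ≤ G ^ (2 - p) := by positivity
      have t1 : 0 ≤ l i * u i ^ 2 := by positivity
      have t2 : 0 ≤ G ^ (2 - p) * (l i * v i ^ p) := by positivity
      rcases le_total (v i) (u i) with hc | hc
      · have h1 := gauge_succ_sq_le hp hε hl ha i
        have h2 : l i * a i ^ 2 ≤ l i * (2 * u i) ^ 2 := by gcongr; linarith
        nlinarith
      · have hgi := gauge_pos (p := p) hε hl ha i
        have hgi1 := gauge_pos (p := p) hε hl ha (i + 1)
        have h1 := rpow_sub_two_mul_sq_sub_sq_le hp1 hgi (gauge_le_succ hp hε hl ha i)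
        have h2 := gauge_succ_rpow_le hp hε hl ha i
        have h3 : l i * a i ^ p ≤ l i * (4 * v i ^ p) := by
          gcongr
          calc a i ^ p ≤ (2 * v i) ^ p := by gcongr; linarith
            _ = 2 ^ p * v i ^ p := Real.mul_rpow (by norm_num) hvi
            _ ≤ 2 ^ (2 : ℝ) * v i ^ p := by gcongr; norm_num
            _ = 4 * v i ^ p := by norm_num
        have h4 : gauge p ε l a (i + 1) ^ (2 - p) ≤ G ^ (2 - p) := by
          have := gauge_mono hp hε hl ha hi
          gcongr
        have h5 : gauge p ε l a (i + 1) ^ (2 - p) * gauge p ε l a (i + 1) ^ (p - 2) = 1 := by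
          rw [← Real.rpow_add hgi1]; simp
        have h6 : gauge p ε l a (i + 1) ^ 2 - gauge p ε l a i ^ 2 ≤
            gauge p ε l a (i + 1) ^ (2 - p) * (8 * (l i * v i ^ p)) := by
          calc gauge p ε l a (i + 1) ^ 2 - gauge p ε l a i ^ 2
              = gauge p ε l a (i + 1) ^ (2 - p) * (gauge p ε l a (i + 1) ^ (p - 2) *
                (gauge p ε l a (i + 1) ^ 2 - gauge p ε l a i ^ 2)) := by
                rw [← mul_assoc, h5, one_mul]
            _ ≤ _ := mul_le_mul_of_nonneg_left (by linarith) (by positivity)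
        have h7 : gauge p ε l a (i + 1) ^ (2 - p) * (8 * (l i * v i ^ p)) ≤
            G ^ (2 - p) * (8 * (l i * v i ^ p)) := by gcongr
        nlinarith
  have hA : 0 ≤ ∑ i ∈ Finset.range n, l i * u i ^ 2 :=
    Finset.sum_nonneg fun i _ => mul_nonneg (hl i) (sq_nonneg _)
  have hB : 0 ≤ ∑ i ∈ Finset.range n, l i * v i ^ p :=
    Finset.sum_nonneg fun i _ => mul_nonneg (hl i) (Real.rpow_nonneg (hv i) _)
  have hk := key n le_rfl
  rw [← hG] at hk
  set A := ∑ i ∈ Finset.range n, l i * u i ^ 2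
  set B := ∑ i ∈ Finset.range n, l i * v i ^ p
  have hAp : 0 ≤ A ^ (p / 2) := by positivity
  have hεp : 0 ≤ ε ^ p := by positivity
  have hw : 0 < G ^ (p - 2) := by positivity
  have e1 : G ^ (p - 2) * G ^ (2 - p) = 1 := by rw [← Real.rpow_add hGpos]; simp
  have e2 := rpow_eq_rpow_sub_two_mul_sq hGpos p
  rcases le_or_gt (G ^ 2) (2 * ε ^ 2 + 8 * A) with hc | hc
  · have h1 : G ^ p ≤ (2 * ε ^ 2) ^ (p / 2) + (8 * A) ^ (p / 2) := by
      rw [← sq_rpow_half hGpos.le]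
      refine (Real.rpow_le_rpow (by positivity) hc (by positivity)).trans ?_
      exact Real.rpow_add_le_add_rpow (by positivity) (by positivity) (by positivity) (by linarith)
    rw [Real.mul_rpow (by norm_num) (by positivity), Real.mul_rpow (by norm_num) hA,
      sq_rpow_half hε.le] at h1
    have h2 : (2 : ℝ) ^ (p / 2) ≤ 2 := by
      calc (2 : ℝ) ^ (p / 2) ≤ 2 ^ (1 : ℝ) :=
            Real.rpow_le_rpow_of_exponent_le (by norm_num) (by linarith)
        _ = 2 := Real.rpow_one _
    have h3 : (8 : ℝ) ^ (p / 2) ≤ 8 := by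
      calc (8 : ℝ) ^ (p / 2) ≤ 8 ^ (1 : ℝ) :=
            Real.rpow_le_rpow_of_exponent_le (by norm_num) (by linarith)
        _ = 8 := Real.rpow_one _
    nlinarith
  · have h1 : G ^ 2 ≤ 16 * (G ^ (2 - p) * B) := by nlinarith
    have h2 : G ^ p ≤ 16 * B := by
      rw [e2]
      calc G ^ (p - 2) * G ^ 2 ≤ G ^ (p - 2) * (16 * (G ^ (2 - p) * B)) := by gcongr
        _ = (G ^ (p - 2) * G ^ (2 - p)) * (16 * B) := by ring
        _ = 16 * B := by rw [e1, one_mul]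
    nlinarith

lemma sum_sq_part_le_gauge (hp : 0 < p) (hε : 0 < ε) (hl : ∀ i, 0 ≤ l i)
    (ha : ∀ i, 0 ≤ a i) (n : ℕ) :
    ∑ i ∈ Finset.range n, (if gauge p ε l a i ^ 2 + l i * a i ^ 2 = gauge p ε l a (i + 1) ^ 2
      then l i * a i ^ 2 else 0) ≤ gauge p ε l a n ^ 2 := by
  induction n with
  | zero => simp [sq_nonneg]
  | succ i ih =>
    rw [Finset.sum_range_succ]
    have hle := gauge_le_succ hp hε hl ha i
    have hg := gauge_pos (p := p) hε hl ha i
    split_ifs with h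
    · linarith
    · nlinarith

lemma sum_rpow_part_le_gauge (hp : 0 < p) (hε : 0 < ε) (hl : ∀ i, 0 ≤ l i)
    (ha : ∀ i, 0 ≤ a i) (n : ℕ) :
    ∑ i ∈ Finset.range n, (if gauge p ε l a i ^ 2 + l i * a i ^ 2 = gauge p ε l a (i + 1) ^ 2
      then 0 else l i * a i ^ p) ≤ gauge p ε l a n ^ p := by
  induction n with
  | zero => simpa using Real.rpow_nonneg (gauge_pos hε hl ha 0).le _
  | succ i ih =>
    rw [Finset.sum_range_succ]
    have hle := gauge_le_succ hp hε hl ha i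
    have hg := gauge_pos (p := p) hε hl ha i
    have h0 : gauge p ε l a i ^ p ≤ gauge p ε l a (i + 1) ^ p := by gcongr
    split_ifs with h
    · linarith
    · have := (gauge_succ_eq_or hp hε hl ha i).resolve_left h
      linarith

/-- Comparison of `gauge` with a nondecreasing sequence `T`. -/
lemma gauge_rpow_le_of_monotone (hp1 : 1 < p) (hp2 : p < 2) (hε : 0 < ε) (hl : ∀ i, 0 ≤ l i)
    (hl1 : ∀ i, l i ≤ 1) (ha : ∀ i, 0 ≤ a i) {T : ℕ → ℝ} (hT0 : ∀ i, 0 ≤ T i) (hT : Monotone T)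
    (n : ℕ) :
    gauge p ε l a n ^ p ≤ ε ^ p + 2 * T n ^ (p / 2) +
      4 * ∑ i ∈ Finset.range n, l i * ((T i + a i ^ 2) ^ (p / 2) - T i ^ (p / 2)) := by
  have hp : 0 < p := by linarith
  have key : ∀ m ≤ n, gauge p ε l a m ^ p ≤ ε ^ p + 2 * T n ^ (p / 2) +
      4 * ∑ i ∈ Finset.range m, l i * ((T i + a i ^ 2) ^ (p / 2) - T i ^ (p / 2)) := by
    intro m
    induction m with
    | zero =>
      intro _
      have := Real.rpow_nonneg (hT0 n) (p / 2)
      simp [gauge]; linarith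
    | succ i ih =>
      intro hi
      have ih' := ih (by omega)
      rw [Finset.sum_range_succ]
      have hli := hl i
      have hai := ha i
      have hTi := hT0 i
      have hTn := hT0 n
      have hTin : T i ≤ T n := hT (by omega)
      have hg := gauge_pos (p := p) hε hl ha i
      have hsq := gauge_succ_sq_le hp hε hl ha i
      have hpw := gauge_succ_rpow_le hp hε hl ha i
      have hinc : ∀ j, 0 ≤ l j * ((T j + a j ^ 2) ^ (p / 2) - T j ^ (p / 2)) := fun j =>
        mul_nonneg (hl j) (sub_nonneg.2 (Real.rpow_le_rpow (hT0 j)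
          (by nlinarith [sq_nonneg (a j)]) (by positivity)))
      have hsum : 0 ≤ ∑ j ∈ Finset.range i, l j * ((T j + a j ^ 2) ^ (p / 2) - T j ^ (p / 2)) :=
        Finset.sum_nonneg fun j _ => hinc j
      have hεp : 0 ≤ ε ^ p := by positivity
      have large : 0 < a i → T i ≤ a i ^ 2 →
          l i * a i ^ p ≤ 4 * (l i * ((T i + a i ^ 2) ^ (p / 2) - T i ^ (p / 2))) := by
        intro h0 h1
        have h2 := rpow_sub_two_mul_sq_le_increment hp1 hp2 hTi h0 hai le_rfl h1
        rw [← rpow_eq_rpow_sub_two_mul_sq h0] at h2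
        have h3 : 0 ≤ a i ^ p := by positivity
        have h4 : a i ^ p ≤ 4 * ((T i + a i ^ 2) ^ (p / 2) - T i ^ (p / 2)) := by nlinarith
        nlinarith
      rcases le_or_gt (T n) (gauge p ε l a i ^ 2) with hc | hc
      · rcases le_or_gt (a i) (gauge p ε l a i) with hd | hd
        · have h2 := rpow_sub_two_mul_sq_le_increment hp1 hp2 hTi hg hai hd (hTin.trans hc)
          have h3 : gauge p ε l a (i + 1) ^ p ≤ gauge p ε l a i ^ p +
              p / 2 * (l i * (gauge p ε l a i ^ (p - 2) * a i ^ 2)) := by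
            have := rpow_le_tangent (q := p / 2) (by linarith) (by linarith)
              (x := gauge p ε l a i ^ 2 + l i * a i ^ 2) (by positivity) (pow_pos hg 2)
            rw [sq_rpow_half hg.le, sq_rpow_half_sub_one hg.le] at this
            rw [← sq_rpow_half (gauge_pos hε hl ha (i + 1)).le]
            refine (Real.rpow_le_rpow (sq_nonneg _) hsq (by positivity)).trans (this.trans ?_)
            apply le_of_eq; ring
          have h4 := mul_le_mul_of_nonneg_left h2 hli
          have h5 := hinc i
          linarith
        · have := large (hg.trans hd) (by nlinarith)
          linarith
      · have h1 : gauge p ε l a i ^ p ≤ T n ^ (p / 2) := by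
          rw [← sq_rpow_half hg.le]
          exact Real.rpow_le_rpow (sq_nonneg _) hc.le (by positivity)
        have h5 := hinc i
        rcases le_or_gt (a i ^ 2) (T n) with hd | hd
        · have h2 : a i ^ p ≤ T n ^ (p / 2) := by
            rw [← sq_rpow_half hai]
            exact Real.rpow_le_rpow (sq_nonneg _) hd (by positivity)
          have h3 : l i * a i ^ p ≤ a i ^ p :=
            mul_le_of_le_one_left (by positivity) (hl1 i)
          linarith
        · have h0 : 0 < a i := by
            rcases hai.eq_or_lt with h | h
            · rw [← h] at hd; nlinarith
            · exact h
          have := large h0 (by linarith)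
          have hTp : 0 ≤ T n ^ (p / 2) := by positivity
          linarith
  exact key n le_rfl

end Gauge

end

section


section Integrability

variable {Ω : Type*} {mΩ : MeasurableSpace Ω} {μ : Measure Ω}

lemma rpow_le_one_add_sq {x q : ℝ} (hx : 0 ≤ x) (hq0 : 0 ≤ q) (hq2 : q ≤ 2) :
    x ^ q ≤ 1 + x ^ 2 := by
  rcases le_total x 1 with h | h
  · have := Real.rpow_le_one hx h hq0
    nlinarith
  · have : x ^ q ≤ x ^ (2 : ℝ) := Real.rpow_le_rpow_of_exponent_le h hq2
    rw [Real.rpow_two] at this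
    linarith

lemma integrable_rpow_of_memLp_two [IsFiniteMeasure μ] {f : Ω → ℝ} (hf : MemLp f 2 μ)
    (hf0 : ∀ ω, 0 ≤ f ω) {q : ℝ} (hq0 : 0 ≤ q) (hq2 : q ≤ 2) :
    Integrable (fun ω => f ω ^ q) μ := by
  refine Integrable.mono' ((integrable_const (1 : ℝ)).add hf.integrable_sq) ?_ ?_
  · exact (hf.1.aemeasurable.pow_const q).aestronglyMeasurable
  · refine Filter.Eventually.of_forall fun ω => ?_
    rw [Real.norm_of_nonneg (Real.rpow_nonneg (hf0 ω) _)]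
    exact rpow_le_one_add_sq (hf0 ω) hq0 hq2

lemma integrable_of_bounded [IsFiniteMeasure μ] {f : Ω → ℝ} (hf : AEStronglyMeasurable f μ)
    (hb : ∃ c, ∀ ω, |f ω| ≤ c) : Integrable f μ := by
  obtain ⟨c, hc⟩ := hb
  exact Integrable.of_bound hf c (Filter.Eventually.of_forall hc)

lemma measurable_partialSups {x : ℕ → Ω → ℝ} {n : ℕ} (hx : ∀ i ≤ n, Measurable (x i)) :
    Measurable fun ω => partialSups (fun i => x i ω) n := by
  induction n with
  | zero => simpa using hx 0 le_rfl
  | succ k ih =>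
    simp only [partialSups_add_one]
    exact (ih fun i hi => hx i (by omega)).sup (hx _ le_rfl)

lemma partialSups_le_sum {x : ℕ → ℝ} (hx : ∀ i, 0 ≤ x i) (n : ℕ) :
    partialSups x n ≤ ∑ i ∈ Finset.range (n + 1), x i :=
  partialSups_le _ _ _ fun j hj =>
    Finset.single_le_sum (f := x) (fun i _ => hx i) (Finset.mem_range.2 (by omega))

lemma memLp_partialSups {x : ℕ → Ω → ℝ} (hx : ∀ i, MemLp (x i) 2 μ)
    (hm : ∀ i, Measurable (x i)) (hx0 : ∀ i ω, 0 ≤ x i ω) (n : ℕ) :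
    MemLp (fun ω => partialSups (fun i => x i ω) n) 2 μ := by
  have hs : MemLp (fun ω => ∑ i ∈ Finset.range (n + 1), x i ω) 2 μ :=
    memLp_finsetSum _ fun i _ => hx i
  refine hs.mono (measurable_partialSups fun i _ => hm i).aestronglyMeasurable ?_
  refine Filter.Eventually.of_forall fun ω => ?_
  have h0 : 0 ≤ partialSups (fun i => x i ω) n :=
    (hx0 0 ω).trans (le_partialSups_of_le (fun i => x i ω) (Nat.zero_le n))
  rw [Real.norm_of_nonneg h0]
  exact (partialSups_le_sum (fun i => hx0 i ω) n).trans (le_abs_self _)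

end Integrability

section Doob

/-- Pathwise form of Doob's `L^p` maximal inequality. -/
lemma doob_pathwise {p : ℝ} (hp1 : 1 < p) {x : ℕ → ℝ} (hx : ∀ i, 0 ≤ x i) (hx0 : x 0 = 0) (n : ℕ) :
    (p - 1) / p * partialSups x n ^ p ≤ partialSups x n ^ (p - 1) * x n -
      ∑ i ∈ Finset.range n, partialSups x i ^ (p - 1) * (x (i + 1) - x i) := by
  induction n with
  | zero => simp [hx0, Real.zero_rpow (by linarith : p ≠ 0)]
  | succ n ih =>
    rw [Finset.sum_range_succ, partialSups_add_one]
    have hs : 0 ≤ partialSups x n := (hx n).trans (le_partialSups x n)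
    rcases le_total (x (n + 1)) (partialSups x n) with h | h
    · rw [sup_eq_left.2 h]
      linarith
    · rw [sup_eq_right.2 h]
      have hy := Real.young_inequality_of_nonneg (Real.rpow_nonneg hs (p - 1)) (hx (n + 1))
        (Real.HolderConjugate.conjExponent hp1).symm
      rw [← Real.rpow_mul hs, Real.conjExponent, mul_div_cancel₀ _ (by linarith : p - 1 ≠ 0)] at hy
      have e : x (n + 1) ^ (p - 1) * x (n + 1) = x (n + 1) ^ p := by
        rw [← Real.rpow_add_one' (hx _) (by linarith), sub_add_cancel]
      have e2 : partialSups x n ^ p / (p / (p - 1)) = (p - 1) / p * partialSups x n ^ p := by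
        field_simp
      have e3 : (p - 1) / p * x (n + 1) ^ p = x (n + 1) ^ p - x (n + 1) ^ p / p := by
        field_simp
      rw [e2] at hy
      rw [e, e3]
      linarith

lemma rpow_sub_one_mul_le {p δ s x : ℝ} (hp1 : 1 < p) (hδ : 0 < δ) (hs : 0 ≤ s) (hx : 0 ≤ x) :
    s ^ (p - 1) * x ≤ δ * s ^ p + δ ^ (1 - p) * x ^ p := by
  have e (z : ℝ) (hz : 0 ≤ z) : z ^ p = z ^ (p - 1) * z := by
    rw [← Real.rpow_add_one' hz (by linarith), sub_add_cancel]
  have hsp : 0 ≤ s ^ (p - 1) := by positivity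
  rcases le_total x (δ * s) with h | h
  · have : 0 ≤ δ ^ (1 - p) * x ^ p := by positivity
    rw [e s hs]
    nlinarith
  · have h1 : s ≤ x / δ := by rw [le_div_iff₀ hδ]; linarith
    have h2 : s ^ (p - 1) ≤ δ ^ (1 - p) * x ^ (p - 1) := by
      calc s ^ (p - 1) ≤ (x / δ) ^ (p - 1) := Real.rpow_le_rpow hs h1 (by linarith)
        _ = δ ^ (1 - p) * x ^ (p - 1) := by
          rw [Real.div_rpow hx hδ.le, div_eq_inv_mul, ← Real.rpow_neg hδ.le, neg_sub]
    have h3 : 0 ≤ δ * s ^ p := by positivity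
    rw [e x hx]
    nlinarith

end Doob

variable {Ω : Type*} {mΩ : MeasurableSpace Ω}

/-- Independent centred increments with the moment bounds of compensated Poisson variables with
parameters at most one. -/
structure IsNoise (μ : Measure Ω) (𝒢 : Filtration ℕ mΩ) (η : ℕ → Ω → ℝ) (lam : ℕ → ℝ) :
    Prop where
  nonneg : ∀ i, 0 ≤ lam i
  le_one : ∀ i, lam i ≤ 1
  meas : ∀ i, Measurable[𝒢 (i + 1)] (η i)
  indep : ∀ i, Indep (MeasurableSpace.comap (η i) inferInstance) (𝒢 i) μ
  memLp : ∀ i, MemLp (η i) 2 μ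
  mean : ∀ i, ∫ ω, η i ω ∂μ = 0
  sq_le : ∀ i, ∫ ω, η i ω ^ 2 ∂μ ≤ lam i
  abs_le : ∀ i, ∫ ω, |η i ω| ∂μ ≤ 2 * lam i
  le_tail : ∀ i, lam i ≤ 4 * μ.real {ω | 1 / 2 ≤ |η i ω|}

/-- A bounded predictable integrand. -/
structure IsPredictable {H : Type*} [NormedAddCommGroup H] (𝒢 : Filtration ℕ mΩ)
    (y : ℕ → Ω → H) : Prop where
  meas : ∀ i, StronglyMeasurable[𝒢 i] (y i)
  bdd : ∀ i, ∃ c : ℝ, ∀ ω, ‖y i ω‖ ≤ c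

/-- The partial sums of the stochastic integral. -/
def stochSum {H : Type*} [NormedAddCommGroup H] [InnerProductSpace ℝ H]
    (η : ℕ → Ω → ℝ) (y : ℕ → Ω → H) (n : ℕ) (ω : Ω) : H :=
  ∑ i ∈ Finset.range n, η i ω • y i ω

section Noise

variable {μ : Measure Ω} {𝒢 : Filtration ℕ mΩ} {η : ℕ → Ω → ℝ}
  {lam : ℕ → ℝ}

lemma IsNoise.measurable (h : IsNoise μ 𝒢 η lam) (i : ℕ) : Measurable (η i) :=
  (h.meas i).mono (𝒢.le _) le_rfl

lemma IsNoise.indepFun (h : IsNoise μ 𝒢 η lam) (i : ℕ) {Z : Ω → ℝ}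
    (hZ : Measurable[𝒢 i] Z) {f : ℝ → ℝ} (hf : Measurable f) :
    IndepFun Z (fun ω => f (η i ω)) μ := by
  have h1 : IndepFun Z (η i) μ := by
    rw [IndepFun_iff_Indep]
    exact indep_of_indep_of_le_left (h.indep i).symm hZ.comap_le
  exact h1.comp (φ := id) measurable_id hf

variable {H : Type*} [NormedAddCommGroup H] {y : ℕ → Ω → H}

lemma IsPredictable.measurable_norm (hy : IsPredictable 𝒢 y) {m n : ℕ} (hmn : m ≤ n) :
    Measurable[𝒢 n] (fun ω => ‖y m ω‖) :=
  ((hy.meas m).mono (𝒢.mono hmn)).norm.measurable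

lemma partialSups_norm_nonneg (x : ℕ → H) (n : ℕ) : 0 ≤ partialSups (fun i => ‖x i‖) n :=
  (norm_nonneg _).trans (le_partialSups (fun i => ‖x i‖) n)

variable [InnerProductSpace ℝ H]

lemma stochSum_succ (n : ℕ) (ω : Ω) :
    stochSum η y (n + 1) ω = stochSum η y n ω + η n ω • y n ω :=
  Finset.sum_range_succ _ _

lemma stronglyMeasurable_stochSum (h : IsNoise μ 𝒢 η lam) (hy : IsPredictable 𝒢 y) {m n : ℕ}
    (hmn : m ≤ n) : StronglyMeasurable[𝒢 n] (stochSum η y m) := by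
  refine Finset.stronglyMeasurable_fun_sum _ fun i hi => ?_
  have hi' := Finset.mem_range.1 hi
  exact ((h.meas i).mono (𝒢.mono (by omega)) le_rfl).stronglyMeasurable.smul
    ((hy.meas i).mono (𝒢.mono (by omega)))

lemma measurable_norm_stochSum (h : IsNoise μ 𝒢 η lam) (hy : IsPredictable 𝒢 y) {m n : ℕ}
    (hmn : m ≤ n) : Measurable[𝒢 n] (fun ω => ‖stochSum η y m ω‖) :=
  (stronglyMeasurable_stochSum h hy hmn).norm.measurable

lemma measurable_inner_stochSum (h : IsNoise μ 𝒢 η lam) (hy : IsPredictable 𝒢 y) (n : ℕ) :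
    Measurable[𝒢 n] (fun ω => inner ℝ (stochSum η y n ω) (y n ω)) :=
  ((stronglyMeasurable_stochSum h hy le_rfl).inner (hy.meas n)).measurable

lemma abs_inner_le_of_bdd {c : ℝ} {x z : H} (hc : ‖z‖ ≤ c) : |inner ℝ x z| ≤ ‖x‖ * c :=
  (abs_real_inner_le_norm x z).trans (by gcongr)

lemma IsNoise.integrable_mul (h : IsNoise μ 𝒢 η lam) (i : ℕ) {Z : Ω → ℝ}
    (hZ : Measurable[𝒢 i] Z) (hZi : Integrable Z μ) {f : ℝ → ℝ} (hf : Measurable f)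
    (hfi : Integrable (fun ω => f (η i ω)) μ) : Integrable (fun ω => Z ω * f (η i ω)) μ :=
  (h.indepFun i hZ hf).integrable_mul hZi hfi

lemma IsNoise.integral_mul (h : IsNoise μ 𝒢 η lam) (i : ℕ) {Z : Ω → ℝ}
    (hZ : Measurable[𝒢 i] Z) {f : ℝ → ℝ} (hf : Measurable f) :
    ∫ ω, Z ω * f (η i ω) ∂μ = (∫ ω, Z ω ∂μ) * ∫ ω, f (η i ω) ∂μ :=
  (h.indepFun i hZ hf).integral_fun_mul_eq_mul_integral
    (hZ.mono (𝒢.le _) le_rfl).aestronglyMeasurable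
    (hf.comp (h.measurable i)).aestronglyMeasurable

lemma IsNoise.integral_mul_self (h : IsNoise μ 𝒢 η lam) (i : ℕ) {Z : Ω → ℝ}
    (hZ : Measurable[𝒢 i] Z) : ∫ ω, Z ω * η i ω ∂μ = 0 := by
  have := h.integral_mul i hZ measurable_id
  simp only [id] at this
  rw [this, h.mean, mul_zero]

lemma memLp_stochSum (h : IsNoise μ 𝒢 η lam) (hy : IsPredictable 𝒢 y) (n : ℕ) :
    MemLp (stochSum η y n) 2 μ := by
  refine memLp_finsetSum _ fun i _ => ?_
  obtain ⟨c, hc⟩ := hy.bdd i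
  refine MemLp.of_le_mul (c := c) (h.memLp i) ?_ ?_
  · exact ((h.measurable i).stronglyMeasurable.smul ((hy.meas i).mono (𝒢.le _))).aestronglyMeasurable
  · refine Filter.Eventually.of_forall fun ω => ?_
    rw [norm_smul, mul_comm]
    gcongr
    exact hc ω

lemma memLp_partialSups_stochSum (h : IsNoise μ 𝒢 η lam) (hy : IsPredictable 𝒢 y) (n : ℕ) :
    MemLp (fun ω => partialSups (fun i => ‖stochSum η y i ω‖) n) 2 μ :=
  memLp_partialSups (fun i => (memLp_stochSum h hy i).norm)
    (fun i => (measurable_norm_stochSum h hy le_rfl).mono (𝒢.le i) le_rfl)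
    (fun _ _ => norm_nonneg _) n

variable [IsProbabilityMeasure μ]

lemma IsNoise.integrable (h : IsNoise μ 𝒢 η lam) (i : ℕ) : Integrable (η i) μ :=
  (h.memLp i).integrable (by norm_num)

lemma IsNoise.integrable_mul_self (h : IsNoise μ 𝒢 η lam) (i : ℕ) {Z : Ω → ℝ}
    (hZ : Measurable[𝒢 i] Z) (hZi : Integrable Z μ) : Integrable (fun ω => Z ω * η i ω) μ :=
  h.integrable_mul i hZ hZi measurable_id (h.integrable i)

/-- A martingale transform of the noise has vanishing expectation. -/
lemma IsNoise.integral_le_of_le_sub (h : IsNoise μ 𝒢 η lam) {Z : ℕ → Ω → ℝ} {n : ℕ}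
    (hZ : ∀ i, Measurable[𝒢 i] (Z i)) (hZi : ∀ i, Integrable (Z i) μ) {F G : Ω → ℝ}
    (hF : Integrable F μ) (hG : Integrable G μ)
    (hle : ∀ ω, F ω ≤ G ω - ∑ i ∈ Finset.range n, Z i ω * η i ω) :
    ∫ ω, F ω ∂μ ≤ ∫ ω, G ω ∂μ := by
  have hs : Integrable (fun ω => ∑ i ∈ Finset.range n, Z i ω * η i ω) μ :=
    integrable_finsetSum _ fun i _ => h.integrable_mul_self i (hZ i) (hZi i)
  have h1 : ∫ ω, (∑ i ∈ Finset.range n, Z i ω * η i ω) ∂μ = 0 := by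
    rw [integral_finsetSum _ fun i _ => h.integrable_mul_self i (hZ i) (hZi i)]
    exact Finset.sum_eq_zero fun i _ => h.integral_mul_self i (hZ i)
  calc ∫ ω, F ω ∂μ ≤ ∫ ω, (G ω - ∑ i ∈ Finset.range n, Z i ω * η i ω) ∂μ :=
        integral_mono hF (hG.sub hs) hle
    _ = ∫ ω, G ω ∂μ := by rw [integral_sub hG hs, h1, sub_zero]

/-- Doob's maximal inequality for the stochastic integral. -/
lemma integral_partialSups_rpow_le (h : IsNoise μ 𝒢 η lam) (hy : IsPredictable 𝒢 y) {p : ℝ}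
    (hp1 : 1 < p) (hp2 : p < 2) (n : ℕ) :
    (p - 1) / (2 * p) * ∫ ω, partialSups (fun i => ‖stochSum η y i ω‖) n ^ p ∂μ ≤
      ((p - 1) / (2 * p)) ^ (1 - p) * ∫ ω, ‖stochSum η y n ω‖ ^ p ∂μ := by
  set δ := (p - 1) / (2 * p) with hδ
  have hδ0 : 0 < δ := div_pos (by linarith) (by linarith)
  have hS := memLp_partialSups_stochSum h hy
  have hS0 : ∀ m ω, 0 ≤ partialSups (fun i => ‖stochSum η y i ω‖) m :=
    fun m ω => partialSups_norm_nonneg _ m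
  rw [← integral_const_mul, ← integral_const_mul]
  refine h.integral_le_of_le_sub (n := n)
    (Z := fun i ω => partialSups (fun i => ‖stochSum η y i ω‖) i ^ (p - 1) *
      (‖stochSum η y i ω‖⁻¹ * inner ℝ (stochSum η y i ω) (y i ω))) ?_ ?_ ?_ ?_ ?_
  · intro i
    have h1 : Measurable[𝒢 i] (fun ω => partialSups (fun i => ‖stochSum η y i ω‖) i) :=
      measurable_partialSups (mΩ := 𝒢 i) fun j hj => measurable_norm_stochSum h hy hj
    exact (h1.pow_const _).mul ((measurable_norm_stochSum h hy le_rfl).inv.mul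
      (measurable_inner_stochSum h hy i))
  · intro i
    obtain ⟨c, hc⟩ := hy.bdd i
    refine Integrable.mono' ((integrable_rpow_of_memLp_two (hS i) (hS0 i) (q := p - 1)
      (by linarith) (by linarith)).mul_const c) ?_ ?_
    · have h1 : Measurable (fun ω => partialSups (fun i => ‖stochSum η y i ω‖) i) :=
        measurable_partialSups fun j hj =>
          (measurable_norm_stochSum h hy hj).mono (𝒢.le i) le_rfl
      exact ((h1.pow_const _).mul
        (((measurable_norm_stochSum h hy le_rfl).mono (𝒢.le i) le_rfl).inv.mul
        ((measurable_inner_stochSum h hy i).mono (𝒢.le i) le_rfl))).aestronglyMeasurable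
    · refine Filter.Eventually.of_forall fun ω => ?_
      rw [Real.norm_eq_abs, abs_mul, abs_of_nonneg (Real.rpow_nonneg (hS0 i ω) _), abs_mul,
        abs_of_nonneg (inv_nonneg.2 (norm_nonneg _))]
      refine mul_le_mul_of_nonneg_left ?_ (Real.rpow_nonneg (hS0 i ω) _)
      have hc0 : 0 ≤ c := (norm_nonneg _).trans (hc ω)
      calc _ ≤ ‖stochSum η y i ω‖⁻¹ * (‖stochSum η y i ω‖ * c) := by
            gcongr
            exact abs_inner_le_of_bdd (hc ω)
        _ = (‖stochSum η y i ω‖⁻¹ * ‖stochSum η y i ω‖) * c := by ring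
        _ ≤ 1 * c := by gcongr; exact inv_mul_le_one
        _ = c := one_mul c
  · exact (integrable_rpow_of_memLp_two (hS n) (hS0 n) (by linarith) hp2.le).const_mul _
  · exact (integrable_rpow_of_memLp_two (memLp_stochSum h hy n).norm (fun _ => norm_nonneg _)
      (by linarith) hp2.le).const_mul _
  · intro ω
    have h1 := doob_pathwise hp1 (x := fun i => ‖stochSum η y i ω‖) (fun _ => norm_nonneg _)
      (by simp [stochSum]) n
    have h2 := rpow_sub_one_mul_le (p := p) hp1 hδ0 (hS0 n ω) (norm_nonneg (stochSum η y n ω))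
    have h3 : ∑ i ∈ Finset.range n, partialSups (fun i => ‖stochSum η y i ω‖) i ^ (p - 1) *
        (‖stochSum η y i ω‖⁻¹ * inner ℝ (stochSum η y i ω) (y i ω)) * η i ω ≤
        ∑ i ∈ Finset.range n, partialSups (fun i => ‖stochSum η y i ω‖) i ^ (p - 1) *
          (‖stochSum η y (i + 1) ω‖ - ‖stochSum η y i ω‖) := by
      refine Finset.sum_le_sum fun i _ => ?_
      rw [mul_assoc]
      refine mul_le_mul_of_nonneg_left ?_ (Real.rpow_nonneg (hS0 i ω) _)
      rw [stochSum_succ]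
      set x := stochSum η y i ω
      set d := η i ω • y i ω with hd
      have e : ‖x‖⁻¹ * inner ℝ x (y i ω) * η i ω = ‖x‖⁻¹ * inner ℝ x d := by
        rw [hd, inner_smul_right]; ring
      rw [e]
      rcases eq_or_ne x 0 with hx | hx
      · simp [hx]
      have hx' : 0 < ‖x‖ := norm_pos_iff.2 hx
      have h4 : inner ℝ x (x + d) ≤ ‖x‖ * ‖x + d‖ := real_inner_le_norm _ _
      rw [inner_add_right, real_inner_self_eq_norm_sq] at h4
      rw [inv_mul_le_iff₀ hx']
      nlinarith
    have e : (p - 1) / p = 2 * δ := by rw [hδ]; field_simp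
    rw [e] at h1
    linarith

end Noise

end

section


section Increments

/-- Increments of the concave function `x ↦ x ^ q` are nonincreasing. -/
lemma rpow_add_sub_rpow_add_le {q A B X : ℝ} (hq0 : 0 ≤ q) (hq1 : q ≤ 1) (hA : 0 ≤ A)
    (hAB : A ≤ B) (hX : 0 ≤ X) : (X + B) ^ q - (X + A) ^ q ≤ B ^ q - A ^ q := by
  rcases hX.eq_or_lt with rfl | hX0
  · simp
  have hD : 0 < X + B - A := by linarith
  have hc := Real.concaveOn_rpow hq0 hq1
  set θ := X / (X + B - A) with hθ
  have hθ0 : 0 ≤ θ := div_nonneg hX hD.le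
  have hθ1 : θ ≤ 1 := by rw [hθ, div_le_one hD]; linarith
  have hθD : θ * (X + B - A) = X := div_mul_cancel₀ _ hD.ne'
  have hX' : X + B ∈ Set.Ici (0 : ℝ) := by simp only [Set.mem_Ici]; linarith
  have h1 := hc.2 (Set.mem_Ici.2 hA) hX' (sub_nonneg.2 hθ1) hθ0 (by ring)
  have h2 := hc.2 (Set.mem_Ici.2 hA) hX' hθ0 (sub_nonneg.2 hθ1) (by ring)
  simp only [smul_eq_mul] at h1 h2
  rw [show (1 - θ) * A + θ * (X + B) = X + A by linear_combination hθD] at h1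
  rw [show θ * A + (1 - θ) * (X + B) = B by linear_combination - hθD] at h2
  linarith

/-- One step of the `ε`-regularised `p`-th power of the norm of the stochastic integral. -/
lemma norm_rpow_step_le {p : ℝ} (hp1 : 1 < p) (hp2 : p < 2) {H : Type*} [NormedAddCommGroup H]
    [InnerProductSpace ℝ H] (x z : H) (r : ℝ) {R R' : ℝ} (hR : 0 < R) (hRR : R ≤ R') :
    √(‖x + r • z‖ ^ 2 + R' ^ 2) ^ p ≤ √(‖x‖ ^ 2 + R ^ 2) ^ p + (R' ^ p - R ^ p) +
      p * √(‖x‖ ^ 2 + R' ^ 2) ^ (p - 2) * inner ℝ x z * r +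
      6 * (min (R' ^ (p - 2) * ‖z‖ ^ 2) (‖z‖ ^ p) * (|r| + r ^ 2)) := by
  have hR' : 0 < R' := hR.trans_le hRR
  have hα : 0 < √(‖x‖ ^ 2 + R' ^ 2) := Real.sqrt_pos.2 (by positivity)
  have hsq : √(‖x‖ ^ 2 + R' ^ 2) ^ 2 = ‖x‖ ^ 2 + R' ^ 2 := Real.sq_sqrt (by positivity)
  have hRα : R' ≤ √(‖x‖ ^ 2 + R' ^ 2) := Real.le_sqrt_of_sq_le (by nlinarith [sq_nonneg ‖x‖])
  have hxα : ‖x‖ ≤ √(‖x‖ ^ 2 + R' ^ 2) := Real.le_sqrt_of_sq_le (by nlinarith [sq_nonneg R'])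
  have h1 := norm_rpow_smooth hp1 hp2 (α := √(‖x‖ ^ 2 + R' ^ 2))
    (β := √(‖x + r • z‖ ^ 2 + R' ^ 2)) (b := ‖r • z‖) (t := inner ℝ x (r • z)) hα
    (Real.sqrt_nonneg _) (norm_nonneg _)
    ((abs_real_inner_le_norm _ _).trans (by gcongr)) (by
      rw [hsq, Real.sq_sqrt (by positivity), norm_add_sq_real]; ring)
  have h2 : √(‖x‖ ^ 2 + R' ^ 2) ^ p ≤ √(‖x‖ ^ 2 + R ^ 2) ^ p + (R' ^ p - R ^ p) := by
    have := rpow_add_sub_rpow_add_le (q := p / 2) (A := R ^ 2) (B := R' ^ 2) (X := ‖x‖ ^ 2)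
      (by linarith) (by linarith) (by positivity) (by gcongr) (by positivity)
    rw [sq_rpow_half hR.le, sq_rpow_half hR'.le] at this
    rw [← sq_rpow_half (Real.sqrt_nonneg (‖x‖ ^ 2 + R' ^ 2)),
      ← sq_rpow_half (Real.sqrt_nonneg (‖x‖ ^ 2 + R ^ 2)), hsq, Real.sq_sqrt (by positivity)]
    linarith
  have h3 : min (√(‖x‖ ^ 2 + R' ^ 2) ^ (p - 2) * ‖r • z‖ ^ 2) (‖r • z‖ ^ p) ≤
      min (R' ^ (p - 2) * ‖z‖ ^ 2) (‖z‖ ^ p) * (|r| + r ^ 2) := by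
    have hK : 0 ≤ |r| + r ^ 2 := by positivity
    rw [min_mul_of_nonneg _ _ hK]
    have hn : ‖r • z‖ = |r| * ‖z‖ := by rw [norm_smul, Real.norm_eq_abs]
    apply min_le_min
    · have hw : √(‖x‖ ^ 2 + R' ^ 2) ^ (p - 2) ≤ R' ^ (p - 2) :=
        Real.rpow_le_rpow_of_nonpos hR' hRα (by linarith)
      calc √(‖x‖ ^ 2 + R' ^ 2) ^ (p - 2) * ‖r • z‖ ^ 2
          ≤ R' ^ (p - 2) * ‖r • z‖ ^ 2 := by gcongr
        _ = R' ^ (p - 2) * ‖z‖ ^ 2 * r ^ 2 := by rw [hn, mul_pow, sq_abs]; ring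
        _ ≤ _ := by gcongr; linarith [abs_nonneg r]
    · rw [hn, Real.mul_rpow (abs_nonneg r) (norm_nonneg z), mul_comm]
      gcongr
      rcases le_total |r| 1 with h | h
      · have := Real.rpow_le_rpow_of_exponent_ge' (abs_nonneg r) h zero_le_one hp1.le
        rw [Real.rpow_one] at this
        nlinarith [sq_nonneg r]
      · have := Real.rpow_le_rpow_of_exponent_le h hp2.le
        rw [Real.rpow_two, sq_abs] at this
        linarith [abs_nonneg r]
  rw [inner_smul_right] at h1
  nlinarith

end Increments

variable {Ω : Type*} {mΩ : MeasurableSpace Ω} {μ : Measure Ω} {𝒢 : Filtration ℕ mΩ}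
  {η : ℕ → Ω → ℝ} {lam : ℕ → ℝ} {H : Type*} [NormedAddCommGroup H] {y : ℕ → Ω → H} {p ε : ℝ}

section GaugeProcess

lemma memLp_sqrt_sq_add_sq {f g : Ω → ℝ} (hf : MemLp f 2 μ) (hg : MemLp g 2 μ) :
    MemLp (fun ω => √(f ω ^ 2 + g ω ^ 2)) 2 μ := by
  refine (hf.norm.add hg.norm).mono ?_ (Filter.Eventually.of_forall fun ω => ?_)
  · exact ((hf.1.aemeasurable.pow_const 2).add
      (hg.1.aemeasurable.pow_const 2)).sqrt.aestronglyMeasurable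
  · rw [Real.norm_of_nonneg (Real.sqrt_nonneg _)]
    refine le_trans ?_ (le_abs_self _)
    simp only [Pi.add_apply, Real.norm_eq_abs]
    refine Real.sqrt_le_iff.2 ⟨by positivity, ?_⟩
    nlinarith [abs_nonneg (f ω), abs_nonneg (g ω), sq_abs (f ω), sq_abs (g ω),
      mul_nonneg (abs_nonneg (f ω)) (abs_nonneg (g ω))]

lemma IsNoise.integrable_mul_normSq [IsFiniteMeasure μ] (h : IsNoise μ 𝒢 η lam)
    (hy : IsPredictable 𝒢 y) (i : ℕ) {f : ℝ → ℝ} (hf : Measurable f)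
    (hfi : Integrable (fun ω => f (η i ω)) μ) :
    Integrable (fun ω => ‖y i ω‖ ^ 2 * f (η i ω)) μ := by
  have hm : Measurable[𝒢 i] (fun ω => ‖y i ω‖ ^ 2) := (hy.measurable_norm le_rfl).pow_const 2
  obtain ⟨c, hc⟩ := hy.bdd i
  refine h.integrable_mul i hm (integrable_of_bounded
    (hm.mono (𝒢.le i) le_rfl).aestronglyMeasurable ⟨c ^ 2, fun ω => ?_⟩) hf hfi
  rw [abs_of_nonneg (by positivity)]
  have := hc ω
  gcongr

lemma measurable_gauge {m : MeasurableSpace Ω} {a : ℕ → Ω → ℝ} {n : ℕ}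
    (ha : ∀ i < n, Measurable (a i)) : Measurable fun ω => gauge p ε lam (fun i => a i ω) n := by
  induction n with
  | zero => exact measurable_const
  | succ k ih =>
    have h1 := ih fun i hi => ha i (by omega)
    have h2 := ha k (by omega)
    simp only [gauge]
    fun_prop

lemma IsPredictable.measurable_gauge (hy : IsPredictable 𝒢 y) {m n : ℕ} (hmn : m ≤ n + 1) :
    Measurable[𝒢 n] fun ω => gauge p ε lam (fun i => ‖y i ω‖) m :=
  PoissonIto.measurable_gauge (m := 𝒢 n) fun _ hi => hy.measurable_norm (by omega)

lemma IsPredictable.gauge_bdd (hy : IsPredictable 𝒢 y) (hp : 0 < p) (hε : 0 < ε)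
    (hl : ∀ i, 0 ≤ lam i) (n : ℕ) :
    ∃ c, ∀ ω, gauge p ε lam (fun i => ‖y i ω‖) n ≤ c := by
  induction n with
  | zero => exact ⟨ε, fun ω => le_rfl⟩
  | succ k ih =>
    obtain ⟨c, hc⟩ := ih
    obtain ⟨d, hd⟩ := hy.bdd k
    refine ⟨√(c ^ 2 + lam k * d ^ 2), fun ω => ?_⟩
    have ha : ∀ i, 0 ≤ ‖y i ω‖ := fun i => norm_nonneg _
    apply Real.le_sqrt_of_sq_le
    refine (gauge_succ_sq_le hp hε hl ha k).trans ?_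
    have h1 := (gauge_pos (p := p) hε hl ha k).le
    have h2 := hl k
    have h3 := hc ω
    have h4 := hd ω
    gcongr

lemma IsPredictable.memLp_gauge [IsFiniteMeasure μ] (hy : IsPredictable 𝒢 y) (hp : 0 < p)
    (hε : 0 < ε) (hl : ∀ i, 0 ≤ lam i) (n : ℕ) :
    MemLp (fun ω => gauge p ε lam (fun i => ‖y i ω‖) n) 2 μ := by
  obtain ⟨c, hc⟩ := hy.gauge_bdd hp hε hl n
  refine MemLp.of_bound ((hy.measurable_gauge (Nat.le_succ n)).mono (𝒢.le n)
    le_rfl).aestronglyMeasurable c (Filter.Eventually.of_forall fun ω => ?_)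
  rw [Real.norm_of_nonneg (gauge_pos hε hl (fun i => norm_nonneg _) n).le]
  exact hc ω

lemma IsPredictable.integrable_gauge_rpow [IsFiniteMeasure μ] (hy : IsPredictable 𝒢 y)
    (hp : 0 < p) (hp2 : p ≤ 2) (hε : 0 < ε) (hl : ∀ i, 0 ≤ lam i) (n : ℕ) :
    Integrable (fun ω => gauge p ε lam (fun i => ‖y i ω‖) n ^ p) μ :=
  integrable_rpow_of_memLp_two (hy.memLp_gauge hp hε hl n)
    (fun _ => (gauge_pos hε hl (fun _ => norm_nonneg _) n).le) hp.le hp2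

end GaugeProcess

variable [InnerProductSpace ℝ H] [IsProbabilityMeasure μ]

section Regularised

/-- Integrability of the predictable integrands produced by differentiating the regularised
`p`-th power. -/
lemma integrable_weight_mul_inner (h : IsNoise μ 𝒢 η lam) (hy : IsPredictable 𝒢 y) (hp0 : 0 ≤ p)
    (hp2 : p ≤ 2) (hε : 0 < ε) (n : ℕ) {R : Ω → ℝ} (hR : Measurable R) (hεR : ∀ ω, ε ≤ R ω) :
    Integrable (fun ω => p * √(‖stochSum η y n ω‖ ^ 2 + R ω ^ 2) ^ (p - 2) *
      inner ℝ (stochSum η y n ω) (y n ω)) μ := by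
  obtain ⟨c, hc⟩ := hy.bdd n
  have hM : Measurable (fun ω => ‖stochSum η y n ω‖) :=
    (measurable_norm_stochSum h hy le_rfl).mono (𝒢.le n) le_rfl
  have hI : Measurable (fun ω => inner ℝ (stochSum η y n ω) (y n ω)) :=
    (measurable_inner_stochSum h hy n).mono (𝒢.le n) le_rfl
  refine Integrable.mono' (((memLp_stochSum h hy n).integrable (by norm_num)).norm.const_mul
    (p * ε ^ (p - 2) * c)) (by fun_prop) (Filter.Eventually.of_forall fun ω => ?_)
  have hεR' := hεR ω
  have h1 : ε ≤ √(‖stochSum η y n ω‖ ^ 2 + R ω ^ 2) :=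
    Real.le_sqrt_of_sq_le (by nlinarith [sq_nonneg ‖stochSum η y n ω‖])
  have h2 : √(‖stochSum η y n ω‖ ^ 2 + R ω ^ 2) ^ (p - 2) ≤ ε ^ (p - 2) :=
    Real.rpow_le_rpow_of_nonpos hε h1 (by linarith)
  rw [Real.norm_eq_abs, abs_mul, abs_of_nonneg (by positivity)]
  calc _ ≤ p * ε ^ (p - 2) * (‖stochSum η y n ω‖ * c) := by
        gcongr
        exact abs_inner_le_of_bdd (hc ω)
    _ = _ := by ring

end Regularised

/-- The `p`-th moment of the stochastic integral is dominated by that of the gauge process. -/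
lemma integral_norm_stochSum_rpow_le (h : IsNoise μ 𝒢 η lam) (hy : IsPredictable 𝒢 y)
    (hp1 : 1 < p) (hp2 : p < 2) (hε : 0 < ε) (n : ℕ) :
    ∫ ω, ‖stochSum η y n ω‖ ^ p ∂μ ≤ 37 * ∫ ω, gauge p ε lam (fun i => ‖y i ω‖) n ^ p ∂μ := by
  have hp : 0 < p := by linarith
  set R : ℕ → Ω → ℝ := fun i ω => gauge p ε lam (fun i => ‖y i ω‖) i with hRdef
  have hRpos : ∀ i ω, 0 < R i ω := fun i ω => gauge_pos hε h.nonneg (fun _ => norm_nonneg _) i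
  have hRle : ∀ i ω, R i ω ≤ R (i + 1) ω :=
    fun i ω => gauge_le_succ hp hε h.nonneg (fun _ => norm_nonneg _) i
  have hεR : ∀ i ω, ε ≤ R i ω := fun i ω => le_gauge hp hε h.nonneg (fun _ => norm_nonneg _) i
  have hRi : ∀ i, Integrable (fun ω => R i ω ^ p) μ :=
    fun i => hy.integrable_gauge_rpow hp hp2.le hε h.nonneg i
  have hRm : ∀ i, Measurable[𝒢 i] (R (i + 1)) := fun i => hy.measurable_gauge le_rfl
  have hRL : ∀ i, MemLp (R i) 2 μ := fun i => hy.memLp_gauge hp hε h.nonneg i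
  have hφi : ∀ i j, Integrable (fun ω => √(‖stochSum η y i ω‖ ^ 2 + R j ω ^ 2) ^ p) μ :=
    fun i j => integrable_rpow_of_memLp_two
      (memLp_sqrt_sq_add_sq (memLp_stochSum h hy i).norm (hRL j))
      (fun _ => Real.sqrt_nonneg _) hp.le hp2.le
  have step : ∀ i, ∫ ω, √(‖stochSum η y (i + 1) ω‖ ^ 2 + R (i + 1) ω ^ 2) ^ p ∂μ ≤
      ∫ ω, √(‖stochSum η y i ω‖ ^ 2 + R i ω ^ 2) ^ p ∂μ +
        37 * (∫ ω, R (i + 1) ω ^ p ∂μ - ∫ ω, R i ω ^ p ∂μ) := by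
    intro i
    set m : Ω → ℝ := fun ω => min (R (i + 1) ω ^ (p - 2) * ‖y i ω‖ ^ 2) (‖y i ω‖ ^ p) with hm
    have hyi : Measurable[𝒢 i] (fun ω => ‖y i ω‖) := hy.measurable_norm le_rfl
    have hmm : Measurable[𝒢 i] m :=
      (((hRm i).pow_const _).mul (hyi.pow_const 2)).min (hyi.pow_const p)
    have hm0 : ∀ ω, 0 ≤ m ω := fun ω => by
      have := hRpos (i + 1) ω
      exact le_min (by positivity) (by positivity)
    have hmi : Integrable m μ := by
      obtain ⟨c, hc⟩ := hy.bdd i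
      refine integrable_of_bounded (hmm.mono (𝒢.le i) le_rfl).aestronglyMeasurable
        ⟨c ^ p, fun ω => ?_⟩
      rw [abs_of_nonneg (hm0 ω)]
      refine (min_le_right _ _).trans ?_
      have := hc ω
      gcongr
    set K : ℝ → ℝ := fun r => |r| + r ^ 2 with hK
    have hKm : Measurable K := by fun_prop
    have hKi : Integrable (fun ω => K (η i ω)) μ :=
      (h.integrable i).abs.add (h.memLp i).integrable_sq
    have hmK : Integrable (fun ω => m ω * K (η i ω)) μ := h.integrable_mul i hmm hmi hKm hKi
    have hKint : ∫ ω, K (η i ω) ∂μ ≤ 3 * lam i := by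
      simp only [hK]
      rw [integral_add (h.integrable i).abs (h.memLp i).integrable_sq]
      linarith [h.sq_le i, h.abs_le i]
    have hE : ∫ ω, m ω * K (η i ω) ∂μ ≤ 6 * (∫ ω, R (i + 1) ω ^ p ∂μ - ∫ ω, R i ω ^ p ∂μ) := by
      rw [h.integral_mul i hmm hKm]
      have h1 : (∫ ω, m ω ∂μ) * ∫ ω, K (η i ω) ∂μ ≤ (∫ ω, m ω ∂μ) * (3 * lam i) :=
        mul_le_mul_of_nonneg_left hKint (integral_nonneg hm0)
      have h2 : ∫ ω, lam i * m ω ∂μ ≤ ∫ ω, 2 * (R (i + 1) ω ^ p - R i ω ^ p) ∂μ :=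
        integral_mono (hmi.const_mul _) (((hRi _).sub (hRi _)).const_mul _) fun ω =>
          mul_min_le_gauge_increment hp1 hε h.nonneg (fun _ => norm_nonneg _) i
      rw [integral_const_mul, integral_const_mul, integral_sub (hRi _) (hRi _)] at h2
      linarith
    set Z : Ω → ℝ := fun ω => p * √(‖stochSum η y i ω‖ ^ 2 + R (i + 1) ω ^ 2) ^ (p - 2) *
      inner ℝ (stochSum η y i ω) (y i ω) with hZ
    have hZm : Measurable[𝒢 i] Z :=
      ((((((measurable_norm_stochSum h hy le_rfl).pow_const 2).add
        ((hRm i).pow_const 2)).sqrt).pow_const _).const_mul p).mul (measurable_inner_stochSum h hy i)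
    have hZi : Integrable Z μ := integrable_weight_mul_inner h hy hp.le hp2.le hε i
      ((hRm i).mono (𝒢.le i) le_rfl) (hεR (i + 1))
    have hZη := h.integrable_mul_self i hZm hZi
    have hΔ : Integrable (fun ω => R (i + 1) ω ^ p - R i ω ^ p) μ := (hRi _).sub (hRi _)
    have hs1 : Integrable (fun ω => √(‖stochSum η y i ω‖ ^ 2 + R i ω ^ 2) ^ p +
        (R (i + 1) ω ^ p - R i ω ^ p)) μ := (hφi i i).add hΔ
    have hs2 : Integrable (fun ω => √(‖stochSum η y i ω‖ ^ 2 + R i ω ^ 2) ^ p +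
        (R (i + 1) ω ^ p - R i ω ^ p) + Z ω * η i ω) μ := hs1.add hZη
    have hle : ∫ ω, √(‖stochSum η y (i + 1) ω‖ ^ 2 + R (i + 1) ω ^ 2) ^ p ∂μ ≤
        ∫ ω, (√(‖stochSum η y i ω‖ ^ 2 + R i ω ^ 2) ^ p + (R (i + 1) ω ^ p - R i ω ^ p) +
          Z ω * η i ω + 6 * (m ω * K (η i ω))) ∂μ := by
      refine integral_mono (hφi _ _) (hs2.add (hmK.const_mul 6)) fun ω => ?_
      simp only [stochSum_succ]
      exact norm_rpow_step_le hp1 hp2 _ _ _ (hRpos i ω) (hRle i ω)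
    rw [integral_add hs2 (hmK.const_mul 6), integral_add hs1 hZη, integral_add (hφi i i) hΔ,
      integral_sub (hRi _) (hRi _), h.integral_mul_self i hZm, integral_const_mul] at hle
    linarith
  have key : ∀ m, ∫ ω, √(‖stochSum η y m ω‖ ^ 2 + R m ω ^ 2) ^ p ∂μ ≤
      37 * ∫ ω, R m ω ^ p ∂μ := by
    intro m
    induction m with
    | zero =>
      have : ∀ ω, √(‖stochSum η y 0 ω‖ ^ 2 + R 0 ω ^ 2) ^ p = R 0 ω ^ p := fun ω => by
        simp [stochSum, Real.sqrt_sq (hRpos 0 ω).le]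
      simp only [this]
      have h0 : 0 ≤ ∫ ω, R 0 ω ^ p ∂μ := integral_nonneg fun ω => Real.rpow_nonneg (hRpos 0 ω).le _
      linarith
    | succ i ih => linarith [step i]
  refine le_trans (integral_mono (integrable_rpow_of_memLp_two (memLp_stochSum h hy n).norm
    (fun _ => norm_nonneg _) hp.le hp2.le) (hφi n n) fun ω => ?_) (key n)
  apply Real.rpow_le_rpow (norm_nonneg _) _ hp.le
  exact Real.le_sqrt_of_sq_le (by nlinarith [sq_nonneg (R n ω)])

end

section


variable {Ω : Type*} {mΩ : MeasurableSpace Ω} {μ : Measure Ω} {𝒢 : Filtration ℕ mΩ}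
  {η : ℕ → Ω → ℝ} {lam : ℕ → ℝ} {H : Type*} [NormedAddCommGroup H] [InnerProductSpace ℝ H]
  {y : ℕ → Ω → H} {p ε : ℝ}

/-- The square function of the stochastic integral. -/
def quadVar (η : ℕ → Ω → ℝ) (y : ℕ → Ω → H) (n : ℕ) (ω : Ω) : ℝ :=
  ∑ i ∈ Finset.range n, ‖η i ω • y i ω‖ ^ 2

lemma quadVar_nonneg (n : ℕ) (ω : Ω) : 0 ≤ quadVar η y n ω :=
  Finset.sum_nonneg fun _ _ => by positivity

lemma rpow_half_le {p Q W : ℝ} (hp1 : 0 ≤ p) (hp2 : p ≤ 2) (hQ : 0 ≤ Q) (hW : 0 < W) :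
    Q ^ (p / 2) ≤ W ^ (p - 2) * Q + W ^ p := by
  rcases le_total Q (W ^ 2) with h | h
  · have h1 : Q ^ (p / 2) ≤ (W ^ 2) ^ (p / 2) := Real.rpow_le_rpow hQ h (by linarith)
    rw [sq_rpow_half hW.le] at h1
    have : 0 ≤ W ^ (p - 2) * Q := by positivity
    linarith
  · have hQ0 : 0 < Q := lt_of_lt_of_le (by positivity) h
    have h1 : Q ^ (p / 2 - 1) ≤ (W ^ 2) ^ (p / 2 - 1) :=
      Real.rpow_le_rpow_of_nonpos (by positivity) h (by linarith)
    rw [sq_rpow_half_sub_one hW.le] at h1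
    have h2 : Q ^ (p / 2) = Q ^ (p / 2 - 1) * Q := by
      rw [← Real.rpow_add_one hQ0.ne', sub_add_cancel]
    have : 0 ≤ W ^ p := by positivity
    rw [h2]
    nlinarith

lemma sqrt_sq_add_sq_rpow_le {p a b : ℝ} (hp0 : 0 ≤ p) (hp2 : p ≤ 2) (ha : 0 ≤ a) (hb : 0 ≤ b) :
    √(a ^ 2 + b ^ 2) ^ p ≤ a ^ p + b ^ p := by
  rw [← sq_rpow_half (Real.sqrt_nonneg _), Real.sq_sqrt (by positivity)]
  refine (Real.rpow_add_le_add_rpow (sq_nonneg a) (sq_nonneg b) (by linarith) (by linarith)).trans ?_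
  rw [sq_rpow_half ha, sq_rpow_half hb]

lemma quadVar_rpow_le_sub (hp1 : 1 < p) (hp2 : p < 2) (hε : 0 < ε) (n : ℕ) (ω : Ω) :
    (p - 1) ^ 2 / 2 * quadVar η y n ω ^ (p / 2) ≤
      (1 + (p - 1) ^ 2 / 2) * (partialSups (fun i => ‖stochSum η y i ω‖) n ^ p + ε ^ p) -
      ∑ i ∈ Finset.range n, p * √(‖stochSum η y i ω‖ ^ 2 + ε ^ 2) ^ (p - 2) *
        inner ℝ (stochSum η y i ω) (y i ω) * η i ω := by
  set s := partialSups (fun i => ‖stochSum η y i ω‖) n with hs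
  set α : ℕ → ℝ := fun i => √(‖stochSum η y i ω‖ ^ 2 + ε ^ 2) with hα
  set W := √(s ^ 2 + ε ^ 2) with hW
  set c := (p - 1) ^ 2 / 2 with hc
  have hc0 : 0 ≤ c := by positivity
  have hs0 : 0 ≤ s := partialSups_norm_nonneg _ n
  have hα0 : ∀ i, 0 < α i := fun i => Real.sqrt_pos.2 (by positivity)
  have hW0 : 0 < W := Real.sqrt_pos.2 (by positivity)
  have hαW : ∀ i ≤ n, α i ≤ W := fun i hi => by
    have : ‖stochSum η y i ω‖ ≤ s := le_partialSups_of_le (fun i => ‖stochSum η y i ω‖) hi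
    exact Real.sqrt_le_sqrt (by gcongr)
  have key : ∀ m ≤ n, c * W ^ (p - 2) * quadVar η y m ω ≤ α m ^ p -
      ∑ i ∈ Finset.range m, p * α i ^ (p - 2) * inner ℝ (stochSum η y i ω) (y i ω) * η i ω := by
    intro m
    induction m with
    | zero =>
      intro _
      simp only [quadVar, Finset.range_zero, Finset.sum_empty, mul_zero, sub_zero]
      exact Real.rpow_nonneg (hα0 0).le _
    | succ i ih =>
      intro hi
      have h1 := ih (by omega)
      have hsq (j : ℕ) : α j ^ 2 = ‖stochSum η y j ω‖ ^ 2 + ε ^ 2 := Real.sq_sqrt (by positivity)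
      have hle : ‖stochSum η y i ω‖ ≤ α i := Real.le_sqrt_of_sq_le (by nlinarith [sq_nonneg ε])
      have h2 := norm_rpow_uniform_convex hp1 hp2 (hα0 i) (hα0 (i + 1)) (hαW i (by omega))
        (hαW _ hi) (norm_nonneg (η i ω • y i ω))
        (t := inner ℝ (stochSum η y i ω) (η i ω • y i ω))
        ((abs_real_inner_le_norm _ _).trans (by gcongr)) (by
          rw [hsq, hsq, stochSum_succ, norm_add_sq_real]; ring)
      rw [inner_smul_right, ← hc] at h2
      rw [Finset.sum_range_succ, quadVar, Finset.sum_range_succ, ← quadVar]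
      linarith
  have h1 := key n le_rfl
  have h2 : α n ^ p ≤ W ^ p := Real.rpow_le_rpow (hα0 n).le (hαW n le_rfl) (by linarith)
  have h3 := mul_le_mul_of_nonneg_left (rpow_half_le (p := p) (by linarith) hp2.le
    (quadVar_nonneg (η := η) (y := y) n ω) hW0) hc0
  have h4 := mul_le_mul_of_nonneg_left (sqrt_sq_add_sq_rpow_le (p := p) (by linarith) hp2.le hs0
    hε.le) (by positivity : 0 ≤ 1 + c)
  linarith

lemma integrable_rpow_half [IsFiniteMeasure μ] {f : Ω → ℝ} (hf : Integrable f μ)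
    (hf0 : ∀ ω, 0 ≤ f ω) (hp0 : 0 ≤ p) (hp2 : p ≤ 2) :
    Integrable (fun ω => f ω ^ (p / 2)) μ := by
  have h1 : MemLp (fun ω => √(f ω)) 2 μ := by
    rw [memLp_two_iff_integrable_sq hf.1.aemeasurable.sqrt.aestronglyMeasurable]
    simpa only [Real.sq_sqrt (hf0 _)] using hf
  have h2 := integrable_rpow_of_memLp_two h1 (fun _ => Real.sqrt_nonneg _) hp0 hp2
  refine h2.congr (Filter.Eventually.of_forall fun ω => ?_)
  simp only
  rw [← sq_rpow_half (Real.sqrt_nonneg _), Real.sq_sqrt (hf0 ω)]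

variable [IsProbabilityMeasure μ]

lemma integrable_quadVar (h : IsNoise μ 𝒢 η lam) (hy : IsPredictable 𝒢 y) (n : ℕ) :
    Integrable (quadVar η y n) μ := by
  refine integrable_finsetSum _ fun i _ => ?_
  have := h.integrable_mul_normSq hy i (f := fun r => r ^ 2) (by fun_prop) (h.memLp i).integrable_sq
  refine this.congr (Filter.Eventually.of_forall fun ω => ?_)
  simp only [norm_smul, mul_pow, Real.norm_eq_abs, sq_abs, mul_comm]

/-- Lower square-function estimate: half of the Burkholder–Davis–Gundy inequality. -/
lemma integral_quadVar_rpow_le (h : IsNoise μ 𝒢 η lam) (hy : IsPredictable 𝒢 y) (hp1 : 1 < p)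
    (hp2 : p < 2) (hε : 0 < ε) (n : ℕ) :
    (p - 1) ^ 2 / 2 * ∫ ω, quadVar η y n ω ^ (p / 2) ∂μ ≤ (1 + (p - 1) ^ 2 / 2) *
      (∫ ω, partialSups (fun i => ‖stochSum η y i ω‖) n ^ p ∂μ + ε ^ p) := by
  have hSi : Integrable (fun ω => partialSups (fun i => ‖stochSum η y i ω‖) n ^ p) μ :=
    integrable_rpow_of_memLp_two (memLp_partialSups_stochSum h hy n)
      (fun _ => partialSups_norm_nonneg _ n) (by linarith) hp2.le
  have hc : ∫ ω, (partialSups (fun i => ‖stochSum η y i ω‖) n ^ p + ε ^ p) ∂μ =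
      ∫ ω, partialSups (fun i => ‖stochSum η y i ω‖) n ^ p ∂μ + ε ^ p := by
    rw [integral_add hSi (integrable_const _)]
    simp
  rw [← hc, ← integral_const_mul, ← integral_const_mul]
  refine h.integral_le_of_le_sub (n := n) (Z := fun i ω =>
      p * √(‖stochSum η y i ω‖ ^ 2 + ε ^ 2) ^ (p - 2) * inner ℝ (stochSum η y i ω) (y i ω))
    (fun i => ?_) (fun i => ?_) ?_ ?_ fun ω => ?_
  · exact ((((((measurable_norm_stochSum h hy le_rfl).pow_const 2).add_const
      (ε ^ 2)).sqrt).pow_const _).const_mul p).mul (measurable_inner_stochSum h hy i)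
  · exact integrable_weight_mul_inner h hy (by linarith) hp2.le hε i measurable_const
      fun _ => le_rfl
  · exact (integrable_rpow_half (integrable_quadVar h hy n) (fun _ => quadVar_nonneg _ _)
      (by linarith) hp2.le).const_mul _
  · exact (hSi.add (integrable_const _)).const_mul _
  · exact quadVar_rpow_le_sub hp1 hp2 hε n ω

/-- The gauge process is dominated by the square function. -/
lemma integral_gauge_rpow_le_quadVar (h : IsNoise μ 𝒢 η lam) (hy : IsPredictable 𝒢 y)
    (hp1 : 1 < p) (hp2 : p < 2) (hε : 0 < ε) (n : ℕ) :
    ∫ ω, gauge p ε lam (fun i => ‖y i ω‖) n ^ p ∂μ ≤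
      ε ^ p + 72 * ∫ ω, quadVar η y n ω ^ (p / 2) ∂μ := by
  have hp : 0 < p := by linarith
  set g : ℝ → ℝ := {r : ℝ | 1 / 2 ≤ |r|}.indicator 1 with hg
  have hgs : MeasurableSet {r : ℝ | 1 / 2 ≤ |r|} := measurableSet_le (by fun_prop) (by fun_prop)
  have hgm : Measurable g := measurable_one.indicator hgs
  have hg01 : ∀ r, g r = 0 ∨ g r = 1 := fun r => Set.indicator_eq_zero_or_self _ 1 r
  have hg0 : ∀ r, 0 ≤ g r := fun r => by rcases hg01 r with e | e <;> simp [e]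
  have hg4 : ∀ r, g r ≤ 4 * r ^ 2 := fun r => by
    by_cases hr : 1 / 2 ≤ |r|
    · rw [hg, Set.indicator_of_mem (show r ∈ {r : ℝ | 1 / 2 ≤ |r|} from hr), Pi.one_apply]
      nlinarith [sq_abs r]
    · rw [hg, Set.indicator_of_notMem (show r ∉ {r : ℝ | 1 / 2 ≤ |r|} from hr)]
      positivity
  have hgi : ∀ i, Integrable (fun ω => g (η i ω)) μ := fun i =>
    integrable_of_bounded (hgm.comp (h.measurable i)).aestronglyMeasurable
      ⟨1, fun ω => by rcases hg01 (η i ω) with e | e <;> simp [e]⟩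
  have hgE : ∀ i, ∫ ω, g (η i ω) ∂μ = μ.real {ω | 1 / 2 ≤ |η i ω|} := fun i => by
    exact integral_indicator_one ((h.measurable i) hgs)
  set T : ℕ → Ω → ℝ := fun i ω => ∑ j ∈ Finset.range i, ‖y j ω‖ ^ 2 * g (η j ω) with hT
  have hTs : ∀ i ω, T (i + 1) ω = T i ω + ‖y i ω‖ ^ 2 * g (η i ω) :=
    fun i ω => Finset.sum_range_succ _ _
  have hT0 : ∀ i ω, 0 ≤ T i ω := fun i ω =>
    Finset.sum_nonneg fun j _ => mul_nonneg (by positivity) (hg0 _)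
  have hTmono : ∀ ω, Monotone fun i => T i ω := fun ω => monotone_nat_of_le_succ fun i => by
    rw [hTs]
    exact le_add_of_nonneg_right (mul_nonneg (by positivity) (hg0 _))
  have hTm : ∀ i, Measurable[𝒢 i] (T i) := fun i => by
    refine Finset.measurable_fun_sum _ fun j hj => ?_
    have hj' := Finset.mem_range.1 hj
    exact ((hy.measurable_norm hj'.le).pow_const 2).mul
      (hgm.comp ((h.meas j).mono (𝒢.mono hj') le_rfl))
  have hTi : ∀ i, Integrable (T i) μ := fun i =>
    integrable_finsetSum _ fun j _ => h.integrable_mul_normSq hy j hgm (hgi j)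
  have hTpi : ∀ i, Integrable (fun ω => T i ω ^ (p / 2)) μ := fun i =>
    integrable_rpow_half (hTi i) (hT0 i) hp.le hp2.le
  have hysq : ∀ i, Integrable (fun ω => ‖y i ω‖ ^ 2) μ := fun i => by
    simpa using h.integrable_mul_normSq hy i (f := fun _ => 1) measurable_const
      (integrable_const _)
  set m : ℕ → Ω → ℝ := fun i ω => (T i ω + ‖y i ω‖ ^ 2) ^ (p / 2) - T i ω ^ (p / 2) with hm
  have hmi : ∀ i, Integrable (m i) μ := fun i =>
    (integrable_rpow_half ((hTi i).add (hysq i)) (fun ω => add_nonneg (hT0 i ω) (by positivity))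
      hp.le hp2.le).sub (hTpi i)
  have hmm : ∀ i, Measurable[𝒢 i] (m i) := fun i =>
    (((hTm i).add ((hy.measurable_norm le_rfl).pow_const 2)).pow_const _).sub
      ((hTm i).pow_const _)
  have hm0 : ∀ i ω, 0 ≤ m i ω := fun i ω => sub_nonneg.2 <|
    Real.rpow_le_rpow (hT0 i ω) (le_add_of_nonneg_right (by positivity)) (by linarith)
  have hmg : ∀ i, (∫ ω, m i ω ∂μ) * μ.real {ω | 1 / 2 ≤ |η i ω|} =
      ∫ ω, T (i + 1) ω ^ (p / 2) ∂μ - ∫ ω, T i ω ^ (p / 2) ∂μ := fun i => by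
    rw [← hgE, ← h.integral_mul i (hmm i) hgm, ← integral_sub (hTpi _) (hTpi _)]
    congr 1
    ext ω
    rw [hTs]
    rcases hg01 (η i ω) with e | e <;> simp [e, hm]
  have hlm : ∀ k, ∑ i ∈ Finset.range k, lam i * ∫ ω, m i ω ∂μ ≤ 4 * ∫ ω, T k ω ^ (p / 2) ∂μ := by
    intro k
    induction k with
    | zero =>
      have : ∀ ω, T 0 ω = 0 := fun ω => by simp [hT]
      simp [this, Real.zero_rpow (by linarith : p / 2 ≠ 0)]
    | succ i ih =>
      rw [Finset.sum_range_succ]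
      have h1 := mul_le_mul_of_nonneg_right (h.le_tail i) (integral_nonneg (hm0 i) : 0 ≤ ∫ ω, m i ω ∂μ)
      have h2 := hmg i
      linarith
  have hTQ : ∫ ω, T n ω ^ (p / 2) ∂μ ≤ 4 * ∫ ω, quadVar η y n ω ^ (p / 2) ∂μ := by
    rw [← integral_const_mul]
    refine integral_mono (hTpi n) ((integrable_rpow_half (integrable_quadVar h hy n)
      (fun _ => quadVar_nonneg _ _) hp.le hp2.le).const_mul _) fun ω => ?_
    have h1 : T n ω ≤ 4 * quadVar η y n ω := by
      rw [quadVar, Finset.mul_sum]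
      refine Finset.sum_le_sum fun i _ => ?_
      rw [norm_smul, mul_pow, Real.norm_eq_abs, sq_abs]
      have := mul_le_mul_of_nonneg_left (hg4 (η i ω)) (sq_nonneg ‖y i ω‖)
      linarith
    calc T n ω ^ (p / 2) ≤ (4 * quadVar η y n ω) ^ (p / 2) :=
          Real.rpow_le_rpow (hT0 n ω) h1 (by linarith)
      _ = 4 ^ (p / 2) * quadVar η y n ω ^ (p / 2) :=
          Real.mul_rpow (by norm_num) (quadVar_nonneg n ω)
      _ ≤ 4 * quadVar η y n ω ^ (p / 2) := by
          refine mul_le_mul_of_nonneg_right ?_ (Real.rpow_nonneg (quadVar_nonneg n ω) _)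
          exact Real.rpow_le_self_of_one_le (by norm_num) (by linarith)
  have hlmi : Integrable (fun ω => ∑ i ∈ Finset.range n, lam i * m i ω) μ :=
    integrable_finsetSum _ fun i _ => (hmi i).const_mul _
  have hb1 : Integrable (fun ω => ε ^ p + 2 * T n ω ^ (p / 2)) μ :=
    (integrable_const _).add ((hTpi n).const_mul 2)
  have hle : ∫ ω, gauge p ε lam (fun i => ‖y i ω‖) n ^ p ∂μ ≤
      ∫ ω, (ε ^ p + 2 * T n ω ^ (p / 2) + 4 * ∑ i ∈ Finset.range n, lam i * m i ω) ∂μ :=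
    integral_mono (hy.integrable_gauge_rpow hp hp2.le hε h.nonneg n)
      (hb1.add (hlmi.const_mul 4)) fun ω =>
      gauge_rpow_le_of_monotone hp1 hp2 hε h.nonneg h.le_one (fun _ => norm_nonneg _)
        (fun i => hT0 i ω) (hTmono ω) n
  rw [integral_add hb1 (hlmi.const_mul 4), integral_add (integrable_const _) ((hTpi n).const_mul 2),
    integral_const_mul, integral_const_mul, integral_finsetSum _ fun i _ => (hmi i).const_mul _]
    at hle
  simp only [integral_const_mul, integral_const, probReal_univ, smul_eq_mul, one_mul] at hle
  linarith [hlm n]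

/-- The gauge process is dominated by the maximal function of the stochastic integral. -/
lemma integral_gauge_rpow_le (h : IsNoise μ 𝒢 η lam) (hy : IsPredictable 𝒢 y) (hp1 : 1 < p)
    (hp2 : p < 2) (hε : 0 < ε) (n : ℕ) :
    (p - 1) ^ 2 / 2 * ∫ ω, gauge p ε lam (fun i => ‖y i ω‖) n ^ p ∂μ ≤
      110 * (∫ ω, partialSups (fun i => ‖stochSum η y i ω‖) n ^ p ∂μ + ε ^ p) := by
  have h1 := integral_quadVar_rpow_le h hy hp1 hp2 hε n
  have h2 := integral_gauge_rpow_le_quadVar h hy hp1 hp2 hε n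
  have hS : 0 ≤ ∫ ω, partialSups (fun i => ‖stochSum η y i ω‖) n ^ p ∂μ :=
    integral_nonneg fun ω => Real.rpow_nonneg (partialSups_norm_nonneg _ n) _
  have he : 0 ≤ ε ^ p := by positivity
  have hc : (p - 1) ^ 2 / 2 ≤ 1 / 2 := by nlinarith
  have hc0 : 0 ≤ (p - 1) ^ 2 / 2 := by positivity
  have h3 := mul_le_mul_of_nonneg_left h2 hc0
  nlinarith

end

section


section PoissonMoments

variable (l : ℝ≥0)

lemma hasSum_poisson_mul_id :
    HasSum (fun n : ℕ => Real.exp (-l) * (l : ℝ) ^ n / (n.factorial : ℝ) * n) l := by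
  rw [← hasSum_nat_add_iff' 1]
  have h := (hasSum_one_poissonMeasure l).mul_left (l : ℝ)
  rw [mul_one] at h
  simp only [Finset.range_one, Finset.sum_singleton, Nat.cast_zero, mul_zero, sub_zero]
  refine h.congr_fun fun n => ?_
  rw [Nat.factorial_succ]
  have : (n.factorial : ℝ) ≠ 0 := by positivity
  push_cast
  field_simp
  ring

lemma hasSum_poisson_mul_mul_sub_one :
    HasSum (fun n : ℕ => Real.exp (-l) * (l : ℝ) ^ n / (n.factorial : ℝ) * (n * (n - 1)))
      ((l : ℝ) ^ 2) := by
  rw [← hasSum_nat_add_iff' 1]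
  have h := (hasSum_poisson_mul_id l).mul_left (l : ℝ)
  simp only [Finset.range_one, Finset.sum_singleton, Nat.cast_zero, zero_mul, mul_zero, sub_zero]
  rw [sq]
  refine h.congr_fun fun n => ?_
  rw [Nat.factorial_succ]
  have : (n.factorial : ℝ) ≠ 0 := by positivity
  push_cast
  field_simp
  ring

lemma hasSum_poisson_mul_sub_sq :
    HasSum (fun n : ℕ => Real.exp (-l) * (l : ℝ) ^ n / (n.factorial : ℝ) * ((n : ℝ) - l) ^ 2)
      (l : ℝ) := by
  have h := ((hasSum_poisson_mul_mul_sub_one l).add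
    ((hasSum_poisson_mul_id l).mul_left (1 - 2 * (l : ℝ)))).add
    ((hasSum_one_poissonMeasure l).mul_left ((l : ℝ) ^ 2))
  convert h using 1
  · ext n; ring
  · ring

lemma integrable_cast_poissonMeasure :
    Integrable (fun n : ℕ => (n : ℝ)) (poissonMeasure l) := by
  rw [integrable_poissonMeasure_iff]
  simpa using (hasSum_poisson_mul_id l).summable

lemma integral_cast_poissonMeasure : ∫ n : ℕ, (n : ℝ) ∂(poissonMeasure l) = l := by
  have := hasSum_integral_poissonMeasure (integrable_cast_poissonMeasure l)
  exact this.unique (hasSum_poisson_mul_id l)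

lemma integrable_sub_sq_poissonMeasure :
    Integrable (fun n : ℕ => ((n : ℝ) - l) ^ 2) (poissonMeasure l) := by
  rw [integrable_poissonMeasure_iff]
  simpa using (hasSum_poisson_mul_sub_sq l).summable

lemma integral_sub_sq_poissonMeasure : ∫ n : ℕ, ((n : ℝ) - l) ^ 2 ∂(poissonMeasure l) = l := by
  have := hasSum_integral_poissonMeasure (integrable_sub_sq_poissonMeasure l)
  exact this.unique (hasSum_poisson_mul_sub_sq l)

lemma integral_sub_poissonMeasure : ∫ n : ℕ, ((n : ℝ) - l) ∂(poissonMeasure l) = 0 := by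
  rw [integral_sub (integrable_cast_poissonMeasure l) (integrable_const _),
    integral_cast_poissonMeasure]
  simp

lemma integral_abs_sub_poissonMeasure_le :
    ∫ n : ℕ, |(n : ℝ) - l| ∂(poissonMeasure l) ≤ 2 * l := by
  have hi := (integrable_cast_poissonMeasure l).sub (integrable_const (l : ℝ))
  calc ∫ n : ℕ, |(n : ℝ) - l| ∂(poissonMeasure l)
      ≤ ∫ n : ℕ, ((n : ℝ) + l) ∂(poissonMeasure l) := by
        refine integral_mono hi.abs ((integrable_cast_poissonMeasure l).add
          (integrable_const _)) fun n => ?_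
        have h1 : (0 : ℝ) ≤ n := n.cast_nonneg
        have h2 : (0 : ℝ) ≤ l := l.coe_nonneg
        simp only
        rw [abs_le]
        constructor <;> linarith
    _ = 2 * l := by
        rw [integral_add (integrable_cast_poissonMeasure l) (integrable_const _),
          integral_cast_poissonMeasure]
        simp
        ring

lemma le_poissonMeasure_tail (hl : l ≤ 1) :
    (l : ℝ) ≤ 4 * (poissonMeasure l).real {n : ℕ | 1 / 2 ≤ |(n : ℝ) - l|} := by
  have hl1 : (l : ℝ) ≤ 1 := hl
  have hl0 : (0 : ℝ) ≤ l := l.coe_nonneg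
  have h0 : (poissonMeasure l).real {0} = Real.exp (-l) := by
    simp [poissonMeasure_real_singleton]
  rcases le_total (l : ℝ) (1 / 2) with h | h
  · have h1 : (poissonMeasure l).real {0}ᶜ ≤
        (poissonMeasure l).real {n : ℕ | 1 / 2 ≤ |(n : ℝ) - l|} := by
      refine measureReal_mono fun n hn => ?_
      have hn1 : (1 : ℝ) ≤ n := by exact_mod_cast Nat.one_le_iff_ne_zero.2 hn
      exact (show (1 : ℝ) / 2 ≤ n - l by linarith).trans (le_abs_self _)
    rw [probReal_compl_eq_one_sub (MeasurableSet.singleton 0), h0] at h1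
    have h2 : Real.exp (-l) * (1 + l) ≤ 1 := by
      calc Real.exp (-l) * (1 + l) ≤ Real.exp (-l) * Real.exp l := by
            gcongr
            linarith [Real.add_one_le_exp (l : ℝ)]
        _ = 1 := by rw [← Real.exp_add]; simp
    nlinarith [Real.exp_pos (-(l : ℝ))]
  · have h1 : (poissonMeasure l).real {0} ≤
        (poissonMeasure l).real {n : ℕ | 1 / 2 ≤ |(n : ℝ) - l|} := by
      refine measureReal_mono fun n hn => ?_
      rw [Set.mem_singleton_iff.1 hn]
      change 1 / 2 ≤ |((0 : ℕ) : ℝ) - l|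
      rw [Nat.cast_zero, zero_sub, abs_neg]
      exact h.trans (le_abs_self _)
    have h2 : 1 / 4 ≤ Real.exp (-l) := by
      calc (1 : ℝ) / 4 ≤ (Real.exp 1)⁻¹ := by
            rw [one_div]
            exact inv_anti₀ (Real.exp_pos 1) (by linarith [Real.exp_one_lt_d9])
        _ = Real.exp (-1) := (Real.exp_neg 1).symm
        _ ≤ _ := Real.exp_le_exp.2 (by linarith)
    linarith

end PoissonMoments

/-- Compensated Poisson variables, shifted to start at index `0` and stopped after `n` steps, form
a noise. -/
lemma isNoise_compensated_poisson {Ω : Type*} {mΩ : MeasurableSpace Ω} {μ : Measure Ω}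
    [IsProbabilityMeasure μ] {𝒢 : Filtration ℕ mΩ} {n : ℕ} {N : ℕ → Ω → ℕ} {lam : ℕ → ℝ≥0}
    (hlam : ∀ i ∈ Finset.Icc 1 n, lam i ≤ 1)
    (hmeas : ∀ i ∈ Finset.Icc 1 n, Measurable[𝒢 i] (N i))
    (hlaw : ∀ i ∈ Finset.Icc 1 n, Measure.map (N i) μ = poissonMeasure (lam i))
    (hindep : ∀ i ∈ Finset.Icc 1 n,
        Indep (MeasurableSpace.comap (N i) inferInstance) (𝒢 (i - 1)) μ) :
    IsNoise μ 𝒢 (fun i ω => if i < n then (N (i + 1) ω : ℝ) - lam (i + 1) else 0)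
      (fun i => if i < n then (lam (i + 1) : ℝ) else 0) := by
  have hI : ∀ {i}, i < n → i + 1 ∈ Finset.Icc 1 n := fun hi => Finset.mem_Icc.2 ⟨by omega, hi⟩
  have hN : ∀ {i}, i < n → Measurable (N (i + 1)) := fun hi =>
    (hmeas _ (hI hi)).mono (𝒢.le _) le_rfl
  have hint : ∀ {i}, i < n → ∀ f : ℕ → ℝ,
      ∫ ω, f (N (i + 1) ω) ∂μ = ∫ k, f k ∂(poissonMeasure (lam (i + 1))) := fun hi f => by
    rw [← hlaw _ (hI hi), integral_map (hN hi).aemeasurable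
      (measurable_of_countable f).aestronglyMeasurable]
  constructor
  · intro i
    split_ifs <;> simp
  · intro i
    split_ifs with hi
    · exact_mod_cast hlam _ (hI hi)
    · simp
  · intro i
    by_cases hi : i < n
    · simp only [hi, if_true]
      exact (measurable_of_countable fun k : ℕ => (k : ℝ) - lam (i + 1)).comp (hmeas _ (hI hi))
    · simp only [hi, if_false]
      exact measurable_const
  · intro i
    by_cases hi : i < n
    · simp only [hi, if_true]
      refine indep_of_indep_of_le_left (hindep _ (hI hi)) ?_
      exact ((measurable_of_countable fun k : ℕ => (k : ℝ) - lam (i + 1)).comp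
        (comap_measurable (N (i + 1)))).comap_le
    · simp only [hi, if_false]
      rw [MeasurableSpace.comap_const]
      exact indep_bot_left _
  · intro i
    by_cases hi : i < n
    · simp only [hi, if_true]
      have hm : AEStronglyMeasurable (fun ω => (N (i + 1) ω : ℝ) - lam (i + 1)) μ :=
        ((measurable_of_countable fun k : ℕ => (k : ℝ) - lam (i + 1)).comp
          (hN hi)).aestronglyMeasurable
      rw [memLp_two_iff_integrable_sq hm]
      have h := integrable_sub_sq_poissonMeasure (lam (i + 1))
      rw [← hlaw _ (hI hi)] at h
      exact h.comp_measurable (hN hi)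
    · simp only [hi, if_false]
      exact MemLp.zero
  · intro i
    by_cases hi : i < n
    · simp only [hi, if_true]
      rw [hint hi fun k => (k : ℝ) - lam (i + 1), integral_sub_poissonMeasure]
    · simp [hi]
  · intro i
    by_cases hi : i < n
    · simp only [hi, if_true]
      rw [hint hi fun k => ((k : ℝ) - lam (i + 1)) ^ 2, integral_sub_sq_poissonMeasure]
    · simp [hi]
  · intro i
    by_cases hi : i < n
    · simp only [hi, if_true]
      rw [hint hi fun k => |(k : ℝ) - lam (i + 1)|]
      exact integral_abs_sub_poissonMeasure_le _
    · simp [hi]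
  · intro i
    by_cases hi : i < n
    · simp only [hi, if_true]
      refine (le_poissonMeasure_tail _ (hlam _ (hI hi))).trans_eq ?_
      rw [← hlaw _ (hI hi), map_measureReal_apply (hN hi) (Set.to_countable _).measurableSet]
      rfl
    · simp [hi]

end

section


lemma le_of_forall_le_add_mul_rpow {a b c p : ℝ} (hp : 0 < p) (hc : 0 ≤ c)
    (h : ∀ ε > 0, a ≤ b + c * ε ^ p) : a ≤ b := by
  refine le_of_forall_pos_le_add fun δ hδ => ?_
  have hδ' : 0 < δ / (c + 1) := by positivity
  have h1 := h ((δ / (c + 1)) ^ (1 / p)) (by positivity)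
  rw [← Real.rpow_mul hδ'.le, one_div_mul_cancel hp.ne', Real.rpow_one] at h1
  have h2 : c * (δ / (c + 1)) ≤ δ := by
    rw [← mul_div_assoc, div_le_iff₀ (by positivity)]
    nlinarith
  linarith

section Integrability

variable {Ω : Type*} {mΩ : MeasurableSpace Ω} {μ : Measure Ω} [IsFiniteMeasure μ]
  {H : Type*} [NormedAddCommGroup H]

lemma integrable_norm_rpow_of_bdd {f : Ω → H} (hf : StronglyMeasurable f)
    (hb : ∃ c : ℝ, ∀ ω, ‖f ω‖ ≤ c) {q : ℝ} (hq : 0 ≤ q) : Integrable (fun ω => ‖f ω‖ ^ q) μ := by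
  obtain ⟨c, hc⟩ := hb
  refine integrable_of_bounded (hf.norm.measurable.pow_const q).aestronglyMeasurable
    ⟨c ^ q, fun ω => ?_⟩
  rw [abs_of_nonneg (by positivity)]
  have := hc ω
  gcongr

lemma integrable_sum_sq_rpow_half {lam : ℕ → ℝ} (hl : ∀ i, 0 ≤ lam i) {u : ℕ → Ω → H} {n : ℕ}
    (hu : ∀ i < n, StronglyMeasurable (u i)) (hub : ∀ i < n, ∃ c : ℝ, ∀ ω, ‖u i ω‖ ≤ c) {p : ℝ}
    (hp0 : 0 ≤ p) (hp2 : p ≤ 2) :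
    Integrable (fun ω => (∑ i ∈ Finset.range n, lam i * ‖u i ω‖ ^ 2) ^ (p / 2)) μ := by
  refine integrable_rpow_half (integrable_finsetSum _ fun i hi => Integrable.const_mul ?_ _)
    (fun ω => Finset.sum_nonneg fun i _ => mul_nonneg (hl i) (by positivity)) hp0 hp2
  have hi' := Finset.mem_range.1 hi
  simpa only [Real.rpow_two] using
    integrable_norm_rpow_of_bdd (μ := μ) (hu i hi') (hub i hi') (zero_le_two (α := ℝ))

end Integrability

variable {Ω : Type*} {mΩ : MeasurableSpace Ω} {μ : Measure Ω} {𝒢 : Filtration ℕ mΩ}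
  {η : ℕ → Ω → ℝ} {lam : ℕ → ℝ} {H : Type*} [NormedAddCommGroup H] {y : ℕ → Ω → H} {p ε : ℝ}

/-- The norm of a decomposition, whose infimum is the norm of the sum space. -/
noncomputable def decompNorm (μ : Measure Ω) (lam : ℕ → ℝ) (p : ℝ) (n : ℕ) (u v : ℕ → Ω → H) :
    ℝ :=
  (∫ ω, (∑ i ∈ Finset.range n, lam i * ‖u i ω‖ ^ 2) ^ (p / 2) ∂μ) ^ (1 / p) +
    (∑ i ∈ Finset.range n, lam i * ∫ ω, ‖v i ω‖ ^ p ∂μ) ^ (1 / p)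

/-- The constant in the upper estimate. -/
noncomputable def upperConst (p : ℝ) : ℝ :=
  (16 * (37 * (((p - 1) / (2 * p)) ^ (1 - p) / ((p - 1) / (2 * p))))) ^ (1 / p)

/-- The inverse of the constant in the lower estimate. -/
noncomputable def lowerConst (p : ℝ) : ℝ :=
  2 * (110 / ((p - 1) ^ 2 / 2)) ^ (1 / p)

lemma upperConst_pos (hp1 : 1 < p) : 0 < upperConst p := by
  have : 0 < (p - 1) / (2 * p) := div_pos (by linarith) (by linarith)
  unfold upperConst
  positivity

lemma lowerConst_pos (hp1 : 1 < p) : 0 < lowerConst p := by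
  have : 0 < p - 1 := by linarith
  unfold lowerConst
  positivity

lemma decompNorm_nonneg (hl : ∀ i, 0 ≤ lam i) (n : ℕ) (u v : ℕ → Ω → H) :
    0 ≤ decompNorm μ lam p n u v :=
  add_nonneg
    (Real.rpow_nonneg (integral_nonneg fun ω => Real.rpow_nonneg
      (Finset.sum_nonneg fun i _ => mul_nonneg (hl i) (by positivity)) _) _)
    (Real.rpow_nonneg (Finset.sum_nonneg fun i _ => mul_nonneg (hl i)
      (integral_nonneg fun ω => by positivity)) _)

variable [IsProbabilityMeasure μ]

/-- The gauge process selects a decomposition which is optimal up to a constant. -/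
lemma exists_decomp_le_gauge (hy : IsPredictable 𝒢 y) (hp1 : 1 < p) (hp2 : p < 2) (hε : 0 < ε)
    (hl : ∀ i, 0 ≤ lam i) (n : ℕ) :
    ∃ u v : ℕ → Ω → H, (∀ i, StronglyMeasurable (u i)) ∧ (∀ i, ∃ c : ℝ, ∀ ω, ‖u i ω‖ ≤ c) ∧
      (∀ i, StronglyMeasurable (v i)) ∧ (∀ i, ∃ c : ℝ, ∀ ω, ‖v i ω‖ ≤ c) ∧
      (∀ i, y i = u i + v i) ∧ decompNorm μ lam p n u v ≤
        2 * (∫ ω, gauge p ε lam (fun i => ‖y i ω‖) n ^ p ∂μ) ^ (1 / p) := by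
  have hp : 0 < p := by linarith
  set R : ℕ → Ω → ℝ := fun i ω => gauge p ε lam (fun i => ‖y i ω‖) i with hR
  have hRm : ∀ i, Measurable (R i) := fun i =>
    (hy.measurable_gauge (Nat.le_succ i)).mono (𝒢.le i) le_rfl
  have hR0 : ∀ i ω, 0 ≤ R i ω := fun i ω => (gauge_pos hε hl (fun _ => norm_nonneg _) i).le
  have hRi := hy.integrable_gauge_rpow (μ := μ) hp hp2.le hε hl n
  have hym : ∀ i, StronglyMeasurable (y i) := fun i => (hy.meas i).mono (𝒢.le i)
  set A : ℕ → Set Ω := fun i => {ω | R i ω ^ 2 + lam i * ‖y i ω‖ ^ 2 = R (i + 1) ω ^ 2} with hA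
  have hAiff : ∀ i ω, ω ∈ A i ↔ gauge p ε lam (fun i => ‖y i ω‖) i ^ 2 + lam i * ‖y i ω‖ ^ 2 =
      gauge p ε lam (fun i => ‖y i ω‖) (i + 1) ^ 2 := fun _ _ => Iff.rfl
  have hAm : ∀ i, MeasurableSet (A i) := fun i => measurableSet_eq_fun
    (((hRm i).pow_const 2).add (((hym i).norm.measurable.pow_const 2).const_mul _))
    ((hRm (i + 1)).pow_const 2)
  have hum : ∀ i, StronglyMeasurable ((A i).indicator (y i)) := fun i => (hym i).indicator (hAm i)
  have hvm : ∀ i, StronglyMeasurable ((A i)ᶜ.indicator (y i)) :=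
    fun i => (hym i).indicator (hAm i).compl
  have hub : ∀ i, ∃ c : ℝ, ∀ ω, ‖(A i).indicator (y i) ω‖ ≤ c := fun i => by
    obtain ⟨c, hc⟩ := hy.bdd i
    exact ⟨c, fun ω => (norm_indicator_le_norm_self _ _).trans (hc ω)⟩
  have hvb : ∀ i, ∃ c : ℝ, ∀ ω, ‖(A i)ᶜ.indicator (y i) ω‖ ≤ c := fun i => by
    obtain ⟨c, hc⟩ := hy.bdd i
    exact ⟨c, fun ω => (norm_indicator_le_norm_self _ _).trans (hc ω)⟩
  refine ⟨fun i => (A i).indicator (y i), fun i => (A i)ᶜ.indicator (y i), hum, hub, hvm, hvb,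
    fun i => (Set.indicator_self_add_compl _ _).symm, ?_⟩
  have h1 : ∫ ω, (∑ i ∈ Finset.range n, lam i * ‖(A i).indicator (y i) ω‖ ^ 2) ^ (p / 2) ∂μ ≤
      ∫ ω, R n ω ^ p ∂μ := by
    refine integral_mono (integrable_sum_sq_rpow_half hl (fun i _ => hum i) (fun i _ => hub i)
      hp.le hp2.le) hRi fun ω => ?_
    simp only
    rw [← sq_rpow_half (hR0 n ω)]
    refine Real.rpow_le_rpow (Finset.sum_nonneg fun i _ => mul_nonneg (hl i) (by positivity)) ?_
      (by linarith)
    refine le_trans (Finset.sum_le_sum fun i _ => ?_)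
      (sum_sq_part_le_gauge hp hε hl (fun i => norm_nonneg (y i ω)) n)
    by_cases hω : ω ∈ A i
    · rw [Set.indicator_of_mem hω, if_pos ((hAiff i ω).1 hω)]
    · rw [Set.indicator_of_notMem hω, if_neg (mt (hAiff i ω).2 hω)]
      simp
  have h2 : ∑ i ∈ Finset.range n, lam i * ∫ ω, ‖(A i)ᶜ.indicator (y i) ω‖ ^ p ∂μ ≤
      ∫ ω, R n ω ^ p ∂μ := by
    have hvi : ∀ i, Integrable (fun ω => lam i * ‖(A i)ᶜ.indicator (y i) ω‖ ^ p) μ :=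
      fun i => (integrable_norm_rpow_of_bdd (hvm i) (hvb i) hp.le).const_mul _
    simp only [← integral_const_mul]
    rw [← integral_finsetSum _ fun i _ => hvi i]
    refine integral_mono (integrable_finsetSum _ fun i _ => hvi i) hRi fun ω => ?_
    refine le_trans (Finset.sum_le_sum fun i _ => ?_)
      (sum_rpow_part_le_gauge hp hε hl (fun i => norm_nonneg (y i ω)) n)
    by_cases hω : ω ∈ A i
    · rw [Set.indicator_of_notMem (Set.notMem_compl_iff.2 hω), if_pos ((hAiff i ω).1 hω)]
      simp [Real.zero_rpow hp.ne']
    · rw [Set.indicator_of_mem (Set.mem_compl hω), if_neg (mt (hAiff i ω).2 hω)]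
  have e1 := Real.rpow_le_rpow (integral_nonneg fun ω => Real.rpow_nonneg
      (Finset.sum_nonneg fun i _ => mul_nonneg (hl i) (by positivity)) _) h1
      (by positivity : 0 ≤ 1 / p)
  have e2 := Real.rpow_le_rpow (Finset.sum_nonneg fun i _ => mul_nonneg (hl i)
      (integral_nonneg fun ω => by positivity)) h2 (by positivity : 0 ≤ 1 / p)
  rw [two_mul]
  exact add_le_add e1 e2

variable [InnerProductSpace ℝ H]

/-- Lower estimate in the Itô isomorphism. -/
lemma exists_decomp_le (h : IsNoise μ 𝒢 η lam) (hy : IsPredictable 𝒢 y) (hp1 : 1 < p)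
    (hp2 : p < 2) (hε : 0 < ε) (n : ℕ) :
    ∃ u v : ℕ → Ω → H, (∀ i, StronglyMeasurable (u i)) ∧ (∀ i, ∃ c : ℝ, ∀ ω, ‖u i ω‖ ≤ c) ∧
      (∀ i, StronglyMeasurable (v i)) ∧ (∀ i, ∃ c : ℝ, ∀ ω, ‖v i ω‖ ≤ c) ∧
      (∀ i, y i = u i + v i) ∧ decompNorm μ lam p n u v ≤ lowerConst p *
        ((∫ ω, partialSups (fun i => ‖stochSum η y i ω‖) n ^ p ∂μ) ^ (1 / p) + ε) := by
  have hp : 0 < p := by linarith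
  obtain ⟨u, v, hu, hub, hv, hvb, huv, hle⟩ :=
    exists_decomp_le_gauge (μ := μ) hy hp1 hp2 hε h.nonneg n
  refine ⟨u, v, hu, hub, hv, hvb, huv, hle.trans ?_⟩
  have h1 := integral_gauge_rpow_le h hy hp1 hp2 hε n
  have hc : 0 < (p - 1) ^ 2 / 2 := by
    have : 0 < p - 1 := by linarith
    positivity
  have hS : 0 ≤ ∫ ω, partialSups (fun i => ‖stochSum η y i ω‖) n ^ p ∂μ :=
    integral_nonneg fun ω => Real.rpow_nonneg (partialSups_norm_nonneg _ n) _
  have hR : 0 ≤ ∫ ω, gauge p ε lam (fun i => ‖y i ω‖) n ^ p ∂μ := integral_nonneg fun ω =>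
    Real.rpow_nonneg (gauge_pos hε h.nonneg (fun _ => norm_nonneg _) n).le _
  have h2 : ∫ ω, gauge p ε lam (fun i => ‖y i ω‖) n ^ p ∂μ ≤ 110 / ((p - 1) ^ 2 / 2) *
      (∫ ω, partialSups (fun i => ‖stochSum η y i ω‖) n ^ p ∂μ + ε ^ p) := by
    rw [div_mul_eq_mul_div, le_div_iff₀ hc]
    linarith
  have h3 := Real.rpow_le_rpow hR h2 (by positivity : 0 ≤ 1 / p)
  rw [Real.mul_rpow (by positivity) (by positivity)] at h3
  have h4 := Real.rpow_add_le_add_rpow hS (by positivity : 0 ≤ ε ^ p)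
    (by positivity : 0 ≤ 1 / p) (by rw [div_le_one hp]; exact hp1.le)
  rw [← Real.rpow_mul hε.le, mul_one_div_cancel hp.ne', Real.rpow_one] at h4
  have h5 := mul_le_mul_of_nonneg_left h4
    (by positivity : 0 ≤ (110 / ((p - 1) ^ 2 / 2)) ^ (1 / p))
  rw [lowerConst, mul_assoc]
  linarith

/-- Upper estimate in the Itô isomorphism. The decomposition need not be adapted. -/
lemma rpow_integral_partialSups_le (h : IsNoise μ 𝒢 η lam) (hy : IsPredictable 𝒢 y)
    (hp1 : 1 < p) (hp2 : p < 2) {n : ℕ} {u v : ℕ → Ω → H}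
    (hu : ∀ i < n, StronglyMeasurable (u i)) (hub : ∀ i < n, ∃ c : ℝ, ∀ ω, ‖u i ω‖ ≤ c)
    (hv : ∀ i < n, StronglyMeasurable (v i)) (hvb : ∀ i < n, ∃ c : ℝ, ∀ ω, ‖v i ω‖ ≤ c)
    (huv : ∀ i < n, y i = u i + v i) :
    (∫ ω, partialSups (fun i => ‖stochSum η y i ω‖) n ^ p ∂μ) ^ (1 / p) ≤
      upperConst p * decompNorm μ lam p n u v := by
  have hp : 0 < p := by linarith
  set δ := (p - 1) / (2 * p) with hδ
  have hδ0 : 0 < δ := div_pos (by linarith) (by linarith)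
  set D := 37 * (δ ^ (1 - p) / δ) with hD
  have hD0 : 0 < D := by positivity
  set S := ∫ ω, partialSups (fun i => ‖stochSum η y i ω‖) n ^ p ∂μ with hS
  set A := ∫ ω, (∑ i ∈ Finset.range n, lam i * ‖u i ω‖ ^ 2) ^ (p / 2) ∂μ with hA
  set B := ∑ i ∈ Finset.range n, lam i * ∫ ω, ‖v i ω‖ ^ p ∂μ with hB
  have hA0 : 0 ≤ A := integral_nonneg fun ω => Real.rpow_nonneg
    (Finset.sum_nonneg fun i _ => mul_nonneg (h.nonneg i) (by positivity)) _
  have hB0 : 0 ≤ B := Finset.sum_nonneg fun i _ => mul_nonneg (h.nonneg i)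
    (integral_nonneg fun ω => by positivity)
  have hS0 : 0 ≤ S := integral_nonneg fun ω => Real.rpow_nonneg (partialSups_norm_nonneg _ n) _
  have hAi := integrable_sum_sq_rpow_half (μ := μ) h.nonneg hu hub hp.le hp2.le
  have hvi : ∀ i ∈ Finset.range n, Integrable (fun ω => lam i * ‖v i ω‖ ^ p) μ := fun i hi =>
    (integrable_norm_rpow_of_bdd (hv i (Finset.mem_range.1 hi)) (hvb i (Finset.mem_range.1 hi))
      hp.le).const_mul _
  have hBi : Integrable (fun ω => ∑ i ∈ Finset.range n, lam i * ‖v i ω‖ ^ p) μ :=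
    integrable_finsetSum _ hvi
  have hBe : ∫ ω, ∑ i ∈ Finset.range n, lam i * ‖v i ω‖ ^ p ∂μ = B := by
    rw [integral_finsetSum _ hvi]
    simp only [integral_const_mul, hB]
  have hR : ∀ ε > 0, ∫ ω, gauge p ε lam (fun i => ‖y i ω‖) n ^ p ∂μ ≤
      2 * ε ^ p + 8 * A + 16 * B := by
    intro ε hε
    have h1 : Integrable (fun ω => 2 * ε ^ p +
        8 * (∑ i ∈ Finset.range n, lam i * ‖u i ω‖ ^ 2) ^ (p / 2)) μ :=
      (integrable_const _).add (hAi.const_mul 8)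
    have h2 : ∫ ω, gauge p ε lam (fun i => ‖y i ω‖) n ^ p ∂μ ≤ ∫ ω, (2 * ε ^ p +
        8 * (∑ i ∈ Finset.range n, lam i * ‖u i ω‖ ^ 2) ^ (p / 2) +
        16 * ∑ i ∈ Finset.range n, lam i * ‖v i ω‖ ^ p) ∂μ :=
      integral_mono (hy.integrable_gauge_rpow hp hp2.le hε h.nonneg n)
        (h1.add (hBi.const_mul 16)) fun ω =>
        gauge_rpow_le_of_le_add hp1 hp2 hε h.nonneg (fun _ => norm_nonneg _)
          (u := fun i => ‖u i ω‖) (v := fun i => ‖v i ω‖) (fun _ => norm_nonneg _)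
          (fun _ => norm_nonneg _) n fun i hi => by
            rw [huv i hi]
            exact norm_add_le _ _
    rw [integral_add h1 (hBi.const_mul 16), integral_add (integrable_const _) (hAi.const_mul 8),
      integral_const_mul, integral_const_mul, integral_const_mul, hBe] at h2
    simpa using h2
  have hSle : S ≤ 16 * D * (A + B) := by
    refine le_of_forall_le_add_mul_rpow hp (c := 2 * D) (by positivity) fun ε hε => ?_
    have h1 := integral_partialSups_rpow_le h hy hp1 hp2 n
    have h2 := integral_norm_stochSum_rpow_le h hy hp1 hp2 hε n
    have h3 := hR ε hε
    have h4 : δ * S ≤ δ ^ (1 - p) * (37 * (2 * ε ^ p + 8 * A + 16 * B)) :=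
      h1.trans (mul_le_mul_of_nonneg_left (by linarith) (by positivity))
    have h5 : S ≤ D * (2 * ε ^ p + 8 * A + 16 * B) := by
      have e : D * (2 * ε ^ p + 8 * A + 16 * B) =
          δ ^ (1 - p) * (37 * (2 * ε ^ p + 8 * A + 16 * B)) / δ := by
        rw [hD]; ring
      rw [e, le_div_iff₀ hδ0]
      linarith
    have h6 : 0 ≤ D * A := by positivity
    linarith
  have h1 := Real.rpow_le_rpow hS0 hSle (by positivity : 0 ≤ 1 / p)
  rw [Real.mul_rpow (by positivity) (by positivity)] at h1
  have h2 := Real.rpow_add_le_add_rpow hA0 hB0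
    (by positivity : 0 ≤ 1 / p) (by rw [div_le_one hp]; exact hp1.le)
  exact h1.trans (mul_le_mul_of_nonneg_left h2 (by positivity))

section Reindexing

lemma sum_Icc_one_eq_sum_range {M : Type*} [AddCommMonoid M] (f : ℕ → M) (n : ℕ) :
    ∑ i ∈ Finset.Icc 1 n, f i = ∑ i ∈ Finset.range n, f (i + 1) := by
  rw [Finset.range_eq_Ico, Finset.sum_Ico_add' f 0 n 1]
  rfl

lemma sup'_Icc_one_eq_partialSups {f g : ℕ → ℝ} {n : ℕ} (hn : (Finset.Icc 1 n).Nonempty)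
    (hfg : ∀ m ∈ Finset.Icc 1 n, f m = g m) (hg0 : g 0 ≤ g 1) :
    (Finset.Icc 1 n).sup' hn f = partialSups g n := by
  have h1n : 1 ≤ n := Finset.nonempty_Icc.1 hn
  apply le_antisymm
  · refine Finset.sup'_le _ _ fun m hm => ?_
    rw [hfg m hm]
    exact le_partialSups_of_le g (Finset.mem_Icc.1 hm).2
  · refine partialSups_le _ _ _ fun m hm => ?_
    have key : ∀ k ∈ Finset.Icc 1 n, g k ≤ (Finset.Icc 1 n).sup' hn f := fun k hk => by
      rw [← hfg k hk]
      exact Finset.le_sup' f hk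
    rcases Nat.eq_zero_or_pos m with rfl | hm0
    · exact hg0.trans (key 1 (Finset.mem_Icc.2 ⟨le_rfl, h1n⟩))
    · exact key m (Finset.mem_Icc.2 ⟨hm0, hm⟩)

end Reindexing

end

end PoissonIto

/-- **Itô isomorphism in Hilbert spaces, case `1 < p < 2`** (discrete model of the
Poisson stochastic integral): for a Hilbert space `H` and `1 < p < 2` there are
constants `c, C > 0` depending only on `p` such that
`c K ≤ (E max_{1≤m≤n} ‖∑_{i=1}^m Ñ_i y_i‖^p)^{1/p} ≤ C K`, where `K` is the infimum of
`(E(∑ λ_i ‖u_i‖²)^{p/2})^{1/p} + (∑ λ_i E‖v_i‖^p)^{1/p}` over all decompositions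
`y_i = u_i + v_i` into bounded strongly measurable `H`-valued random variables. -/
theorem poisson_ito_isomorphism_hilbert_p_lt_two (p : ℝ) (hp1 : 1 < p) (hp2 : p < 2) :
    ∃ c C : ℝ, 0 < c ∧ 0 < C ∧
    ∀ (H : Type) (_ : NormedAddCommGroup H), ∀ (_ : InnerProductSpace ℝ H)
      (_ : CompleteSpace H),
    ∀ (Ω : Type) (mΩ : MeasurableSpace Ω) (μ : Measure Ω), IsProbabilityMeasure μ →
    ∀ (𝒢 : Filtration ℕ mΩ) (n : ℕ) (hn : 1 ≤ n)
      (N : ℕ → Ω → ℕ) (lam : ℕ → ℝ≥0) (y : ℕ → Ω → H),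
      (∀ i ∈ Finset.Icc 1 n, lam i ≤ 1) →
      (∀ i ∈ Finset.Icc 1 n, Measurable[𝒢 i] (N i)) →
      (∀ i ∈ Finset.Icc 1 n, Measure.map (N i) μ = poissonMeasure (lam i)) →
      (∀ i ∈ Finset.Icc 1 n,
        Indep (MeasurableSpace.comap (N i) inferInstance) (𝒢 (i - 1)) μ) →
      (∀ i ∈ Finset.Icc 1 n, StronglyMeasurable[𝒢 (i - 1)] (y i)) →
      (∀ i ∈ Finset.Icc 1 n, ∃ c' : ℝ, ∀ ω, ‖y i ω‖ ≤ c') →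
      c * sInf { r : ℝ | ∃ u v : ℕ → Ω → H,
            (∀ i ∈ Finset.Icc 1 n, StronglyMeasurable (u i)) ∧
            (∀ i ∈ Finset.Icc 1 n, ∃ c' : ℝ, ∀ ω, ‖u i ω‖ ≤ c') ∧
            (∀ i ∈ Finset.Icc 1 n, StronglyMeasurable (v i)) ∧
            (∀ i ∈ Finset.Icc 1 n, ∃ c' : ℝ, ∀ ω, ‖v i ω‖ ≤ c') ∧
            (∀ i ∈ Finset.Icc 1 n, y i = u i + v i) ∧
            r = (∫ ω, (∑ i ∈ Finset.Icc 1 n, (lam i : ℝ) * ‖u i ω‖ ^ (2 : ℝ)) ^ (p / 2) ∂μ) ^ (1 / p)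
              + (∑ i ∈ Finset.Icc 1 n, (lam i : ℝ) * ∫ ω, ‖v i ω‖ ^ p ∂μ) ^ (1 / p) }
        ≤ (∫ ω, ((Finset.Icc 1 n).sup' (Finset.nonempty_Icc.mpr hn) fun m =>
              ‖∑ i ∈ Finset.Icc 1 m, ((N i ω : ℝ) - lam i) • y i ω‖) ^ p ∂μ) ^ (1 / p) ∧
      (∫ ω, ((Finset.Icc 1 n).sup' (Finset.nonempty_Icc.mpr hn) fun m =>
            ‖∑ i ∈ Finset.Icc 1 m, ((N i ω : ℝ) - lam i) • y i ω‖) ^ p ∂μ) ^ (1 / p)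
        ≤ C * sInf { r : ℝ | ∃ u v : ℕ → Ω → H,
            (∀ i ∈ Finset.Icc 1 n, StronglyMeasurable (u i)) ∧
            (∀ i ∈ Finset.Icc 1 n, ∃ c' : ℝ, ∀ ω, ‖u i ω‖ ≤ c') ∧
            (∀ i ∈ Finset.Icc 1 n, StronglyMeasurable (v i)) ∧
            (∀ i ∈ Finset.Icc 1 n, ∃ c' : ℝ, ∀ ω, ‖v i ω‖ ≤ c') ∧
            (∀ i ∈ Finset.Icc 1 n, y i = u i + v i) ∧
            r = (∫ ω, (∑ i ∈ Finset.Icc 1 n, (lam i : ℝ) * ‖u i ω‖ ^ (2 : ℝ)) ^ (p / 2) ∂μ) ^ (1 / p)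
              + (∑ i ∈ Finset.Icc 1 n, (lam i : ℝ) * ∫ ω, ‖v i ω‖ ^ p ∂μ) ^ (1 / p) } := by
  have hp : 0 < p := by linarith
  refine ⟨(PoissonIto.lowerConst p)⁻¹, PoissonIto.upperConst p,
    inv_pos.2 (PoissonIto.lowerConst_pos hp1), PoissonIto.upperConst_pos hp1, ?_⟩
  intro H _ _ _ Ω mΩ μ _ 𝒢 n hn N lam y hlam hmeas hlaw hindep hym hyb
  have hnoise := PoissonIto.isNoise_compensated_poisson hlam hmeas hlaw hindep
  set E : ℕ → Ω → ℝ := fun i ω => if i < n then (N (i + 1) ω : ℝ) - lam (i + 1) else 0 with hE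
  set L : ℕ → ℝ := fun i => if i < n then (lam (i + 1) : ℝ) else 0 with hL
  set Y : ℕ → Ω → H := fun i => if i < n then y (i + 1) else 0 with hY
  have hI : ∀ {i}, i < n → i + 1 ∈ Finset.Icc 1 n := fun hi => Finset.mem_Icc.2 ⟨by omega, hi⟩
  have hYi : ∀ {i}, i < n → Y i = y (i + 1) := fun hi => if_pos hi
  have hpred : PoissonIto.IsPredictable 𝒢 Y := by
    constructor <;> intro i <;> by_cases hi : i < n
    · rw [hYi hi]
      exact hym _ (hI hi)
    · simp only [hY, hi, if_false]
      exact stronglyMeasurable_zero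
    · rw [hYi hi]
      exact hyb _ (hI hi)
    · exact ⟨0, fun ω => by simp [hY, hi]⟩
  have hsup : ∀ ω, ((Finset.Icc 1 n).sup' (Finset.nonempty_Icc.mpr hn) fun m =>
      ‖∑ i ∈ Finset.Icc 1 m, ((N i ω : ℝ) - lam i) • y i ω‖) =
      partialSups (fun i => ‖PoissonIto.stochSum E Y i ω‖) n := fun ω => by
    refine PoissonIto.sup'_Icc_one_eq_partialSups _ (fun m hm => ?_) ?_
    · rw [PoissonIto.sum_Icc_one_eq_sum_range, PoissonIto.stochSum]
      congr 1
      refine Finset.sum_congr rfl fun i hi => ?_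
      have hin : i < n := (Finset.mem_range.1 hi).trans_le (Finset.mem_Icc.1 hm).2
      rw [hYi hin]
      simp only [hE, hin, if_true]
    · simp [PoissonIto.stochSum]
  simp only [hsup]
  set I := (∫ ω, partialSups (fun i => ‖PoissonIto.stochSum E Y i ω‖) n ^ p ∂μ) ^ (1 / p) with hIdef
  have hdec : ∀ u v : ℕ → Ω → H,
      (∫ ω, (∑ i ∈ Finset.Icc 1 n, (lam i : ℝ) * ‖u i ω‖ ^ (2 : ℝ)) ^ (p / 2) ∂μ) ^ (1 / p) +
        (∑ i ∈ Finset.Icc 1 n, (lam i : ℝ) * ∫ ω, ‖v i ω‖ ^ p ∂μ) ^ (1 / p) =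
      PoissonIto.decompNorm μ L p n (fun i => u (i + 1)) (fun i => v (i + 1)) := fun u v => by
    have hLi : ∀ i ∈ Finset.range n, L i = lam (i + 1) := fun i hi =>
      if_pos (Finset.mem_range.1 hi)
    simp only [PoissonIto.decompNorm, PoissonIto.sum_Icc_one_eq_sum_range, Real.rpow_two]
    congr 2
    · congr 1
      ext ω
      congr 1
      exact Finset.sum_congr rfl fun i hi => by rw [hLi i hi]
    · exact Finset.sum_congr rfl fun i hi => by rw [hLi i hi]
  simp only [hdec]
  set S := { r : ℝ | ∃ u v : ℕ → Ω → H,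
    (∀ i ∈ Finset.Icc 1 n, StronglyMeasurable (u i)) ∧
    (∀ i ∈ Finset.Icc 1 n, ∃ c' : ℝ, ∀ ω, ‖u i ω‖ ≤ c') ∧
    (∀ i ∈ Finset.Icc 1 n, StronglyMeasurable (v i)) ∧
    (∀ i ∈ Finset.Icc 1 n, ∃ c' : ℝ, ∀ ω, ‖v i ω‖ ≤ c') ∧
    (∀ i ∈ Finset.Icc 1 n, y i = u i + v i) ∧
    r = PoissonIto.decompNorm μ L p n (fun i => u (i + 1)) (fun i => v (i + 1)) } with hS
  have hmem : ∀ ε > 0, ∃ r ∈ S, r ≤ PoissonIto.lowerConst p * (I + ε) := fun ε hε => by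
    obtain ⟨u, v, hu, hub, hv, hvb, huv, hle⟩ :=
      PoissonIto.exists_decomp_le hnoise hpred hp1 hp2 hε n
    refine ⟨_, ⟨fun i => u (i - 1), fun i => v (i - 1), fun i _ => hu _, fun i _ => hub _,
      fun i _ => hv _, fun i _ => hvb _, fun i hi => ?_, rfl⟩, hle⟩
    obtain ⟨hi1, hin⟩ := Finset.mem_Icc.1 hi
    rw [← huv, hYi (by omega), Nat.sub_add_cancel hi1]
  have hbdd : BddBelow S := by
    refine ⟨0, ?_⟩
    rintro r ⟨u, v, -, -, -, -, -, rfl⟩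
    exact PoissonIto.decompNorm_nonneg hnoise.nonneg n _ _
  constructor
  · rw [inv_mul_le_iff₀ (PoissonIto.lowerConst_pos hp1)]
    refine PoissonIto.le_of_forall_le_add_mul_rpow one_pos (PoissonIto.lowerConst_pos hp1).le
      fun ε hε => ?_
    obtain ⟨r, hr, hle⟩ := hmem ε hε
    rw [Real.rpow_one, ← mul_add]
    exact (csInf_le hbdd hr).trans hle
  · rw [← div_le_iff₀' (PoissonIto.upperConst_pos hp1)]
    obtain ⟨r, hr, -⟩ := hmem 1 one_pos
    refine le_csInf ⟨r, hr⟩ ?_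
    rintro _ ⟨u, v, hu, hub, hv, hvb, huv, rfl⟩
    rw [div_le_iff₀' (PoissonIto.upperConst_pos hp1)]
    exact PoissonIto.rpow_integral_partialSups_le hnoise hpred hp1 hp2
      (fun i hi => hu _ (hI hi)) (fun i hi => hub _ (hI hi)) (fun i hi => hv _ (hI hi))
      (fun i hi => hvb _ (hI hi)) fun i hi => by rw [hYi hi]; exact huv _ (hI hi)
end

section
/- Itô duality for adapted Poisson stochastic integrals (discrete form): Let X be a real Banach space with dual X*, and let (Ω, ℱ, ℙ) be a probability space with a filtration 𝒢_0 ⊆ 𝒢_1 ⊆ ... ⊆ 𝒢_n ⊆ ℱ. For i = 1,...,n let N_i be a random variable that is Poisson distributed with parameter λ_i ∈ [0, ∞), is 𝒢_i-measurable, and is independent of 𝒢_{i-1}, and set Ñ_i = N_i − λ_i. Let Φ_i : Ω → X and Ψ_i : Ω → X* be bounded and strongly 𝒢_{i-1}-measurable (i = 1,...,n). Then E⟨ ∑_{i=1}^n Ñ_i Φ_i , ∑_{j=1}^n Ñ_j Ψ_j ⟩ = ∑_{i=1}^n λ_i · E⟨Φ_i, Ψ_i⟩. -/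
open MeasureTheory ProbabilityTheory
open scoped ENNReal NNReal

/-- The Chen–Stein identity `E[N g(N - 1)] = r E[g(N)]` for the Poisson weights. -/
lemma hasSum_poisson_weights_mul_shift (r : ℝ≥0) {g : ℕ → ℝ} {a : ℝ}
    (h : HasSum (fun n ↦ Real.exp (-r) * r ^ n / n.factorial * g n) a) :
    HasSum (fun n ↦ Real.exp (-r) * r ^ n / n.factorial * (n * g (n - 1))) (r * a) := by
  rw [← hasSum_nat_add_iff' 1]
  convert! h.mul_left (r : ℝ) using 1
  · ext n
    have : (n.factorial : ℝ) ≠ 0 := by positivity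
    simp only [Nat.factorial_succ, Nat.add_sub_cancel]
    push_cast
    field_simp
    ring
  · simp

lemma hasSum_poisson_weights_mul_id (r : ℝ≥0) :
    HasSum (fun n : ℕ ↦ Real.exp (-r) * r ^ n / n.factorial * (n : ℝ)) r := by
  simpa using hasSum_poisson_weights_mul_shift r (g := fun _ ↦ 1) (a := 1)
    (by simpa using hasSum_one_poissonMeasure r)

lemma hasSum_poisson_weights_mul_sq (r : ℝ≥0) :
    HasSum (fun n : ℕ ↦ Real.exp (-r) * r ^ n / n.factorial * (n : ℝ) ^ 2) (r * (r + 1)) := by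
  have h := hasSum_poisson_weights_mul_shift r (g := fun n ↦ (n : ℝ) + 1) (a := r + 1) (by
    simpa [mul_add] using (hasSum_poisson_weights_mul_id r).add (hasSum_one_poissonMeasure r))
  convert! h using 2 with n
  rcases n with _ | n <;> simp [sq]

lemma integrable_sq_poissonMeasure (r : ℝ≥0) :
    Integrable (fun n : ℕ ↦ (n : ℝ) ^ 2) (poissonMeasure r) := by
  rw [integrable_poissonMeasure_iff]
  simpa using (hasSum_poisson_weights_mul_sq r).summable

lemma memLp_two_sub_poissonMeasure (r : ℝ≥0) :
    MemLp (fun n : ℕ ↦ (n : ℝ) - r) 2 (poissonMeasure r) :=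
  ((memLp_two_iff_integrable_sq .of_discrete).2 (integrable_sq_poissonMeasure r)).sub
    (memLp_const _)

lemma integral_id_poissonMeasure (r : ℝ≥0) : ∫ n : ℕ, (n : ℝ) ∂poissonMeasure r = r := by
  rw [integral_poissonMeasure]
  exact (hasSum_poisson_weights_mul_id r).tsum_eq

lemma integrable_id_poissonMeasure (r : ℝ≥0) :
    Integrable (fun n : ℕ ↦ (n : ℝ)) (poissonMeasure r) := by
  rw [integrable_poissonMeasure_iff]
  simpa using (hasSum_poisson_weights_mul_id r).summable

lemma integral_sub_poissonMeasure (r : ℝ≥0) :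
    ∫ n : ℕ, ((n : ℝ) - r) ∂poissonMeasure r = 0 := by
  rw [integral_sub (integrable_id_poissonMeasure r) (integrable_const _),
    integral_id_poissonMeasure]
  simp

lemma integral_sub_sq_poissonMeasure (r : ℝ≥0) :
    ∫ n : ℕ, ((n : ℝ) - r) ^ 2 ∂poissonMeasure r = r := by
  have h : HasSum (fun n : ℕ ↦ Real.exp (-r) * r ^ n / n.factorial * ((n : ℝ) - r) ^ 2) r := by
    convert! ((hasSum_poisson_weights_mul_sq r).sub
      ((hasSum_poisson_weights_mul_id r).mul_left (2 * r : ℝ))).add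
      ((hasSum_one_poissonMeasure r).mul_left ((r : ℝ) ^ 2)) using 1
    · ext n
      ring
    · ring
  rw [integral_poissonMeasure]
  exact h.tsum_eq

/-- The expectation of `f(N) Y` factorizes when `N` is independent of a σ-algebra for which `Y` is
measurable. -/
lemma integral_comp_mul_eq_of_indep {Ω : Type*} {m mΩ : MeasurableSpace Ω} {μ : Measure Ω}
    (hm : m ≤ mΩ) {N : Ω → ℕ} (hN : Measurable N)
    (hind : Indep (MeasurableSpace.comap N inferInstance) m μ) (f : ℕ → ℝ) {Y : Ω → ℝ}
    (hY : StronglyMeasurable[m] Y) :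
    ∫ ω, f (N ω) * Y ω ∂μ = (∫ n, f n ∂(μ.map N)) * ∫ ω, Y ω ∂μ := by
  have hNY : IndepFun N Y μ :=
    (IndepFun_iff_Indep N Y μ).2 (indep_of_indep_of_le_right hind hY.measurable.comap_le)
  rw [integral_map hN.aemeasurable .of_discrete]
  exact (hNY.comp (φ := f) (ψ := id) .of_discrete measurable_id).integral_fun_mul_eq_mul_integral
    ((Measurable.of_discrete (f := f)).comp hN).aestronglyMeasurable
    (hY.mono hm).aestronglyMeasurable

/-- **Itô duality for adapted Poisson stochastic integrals (discrete form).**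
With `Ñ_i = N_i - λ_i` compensated Poisson variables adapted to a filtration `𝒢`
(each `N_i` being `𝒢_i`-measurable, Poisson with parameter `λ_i`, and independent of
`𝒢_{i-1}`) and `Φ_i : Ω → X`, `Ψ_i : Ω → X*` bounded and strongly `𝒢_{i-1}`-measurable,
`E⟨∑ Ñ_i Φ_i, ∑ Ñ_j Ψ_j⟩ = ∑ λ_i E⟨Φ_i, Ψ_i⟩`. -/
theorem poisson_ito_duality
    {Ω : Type*} {mΩ : MeasurableSpace Ω} {μ : Measure Ω} [IsProbabilityMeasure μ]
    (X : Type*) [NormedAddCommGroup X] [NormedSpace ℝ X]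
    (𝒢 : Filtration ℕ mΩ) (n : ℕ)
    (N : ℕ → Ω → ℕ) (lam : ℕ → ℝ≥0)
    (hNmeas : ∀ i ∈ Finset.Icc 1 n, Measurable[𝒢 i] (N i))
    (hlaw : ∀ i ∈ Finset.Icc 1 n, Measure.map (N i) μ = poissonMeasure (lam i))
    (hindep : ∀ i ∈ Finset.Icc 1 n,
      Indep (MeasurableSpace.comap (N i) inferInstance) (𝒢 (i - 1)) μ)
    (Φ : ℕ → Ω → X) (Ψ : ℕ → Ω → (X →L[ℝ] ℝ))
    (hΦmeas : ∀ i ∈ Finset.Icc 1 n, StronglyMeasurable[𝒢 (i - 1)] (Φ i))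
    (hΦbdd : ∀ i ∈ Finset.Icc 1 n, ∃ c : ℝ, ∀ ω, ‖Φ i ω‖ ≤ c)
    (hΨmeas : ∀ i ∈ Finset.Icc 1 n, StronglyMeasurable[𝒢 (i - 1)] (Ψ i))
    (hΨbdd : ∀ i ∈ Finset.Icc 1 n, ∃ c : ℝ, ∀ ω, ‖Ψ i ω‖ ≤ c) :
    ∫ ω, (∑ j ∈ Finset.Icc 1 n, ((N j ω : ℝ) - lam j) • Ψ j ω)
        (∑ i ∈ Finset.Icc 1 n, ((N i ω : ℝ) - lam i) • Φ i ω) ∂μ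
      = ∑ i ∈ Finset.Icc 1 n, (lam i : ℝ) * ∫ ω, (Ψ i ω) (Φ i ω) ∂μ := by
  set K : ℕ → Ω → ℝ := fun i ω ↦ (N i ω : ℝ) - lam i with hK
  have hN (i) (hi : i ∈ Finset.Icc 1 n) : Measurable (N i) :=
    (hNmeas i hi).mono (𝒢.le i) le_rfl
  have hKL (i) (hi : i ∈ Finset.Icc 1 n) : MemLp (K i) 2 μ := by
    have h := memLp_two_sub_poissonMeasure (lam i)
    rw [← hlaw i hi] at h
    exact h.comp_of_map (hN i hi).aemeasurable
  have hKm (i) (hi : i ∈ Finset.Icc 1 n) {l : ℕ} (hl : i ≤ l) : StronglyMeasurable[𝒢 l] (K i) :=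
    (((Measurable.of_discrete (f := fun k : ℕ ↦ (k : ℝ) - lam i)).comp
      (hNmeas i hi)).stronglyMeasurable).mono (𝒢.mono hl)
  have hB {l : ℕ} (j) (hj : j ∈ Finset.Icc 1 n) (i) (hi : i ∈ Finset.Icc 1 n)
      (hjl : j - 1 ≤ l) (hil : i - 1 ≤ l) : StronglyMeasurable[𝒢 l] fun ω ↦ Ψ j ω (Φ i ω) :=
    isBoundedBilinearMap_apply.continuous.comp_stronglyMeasurable
      (((hΨmeas j hj).mono (𝒢.mono hjl)).prodMk ((hΦmeas i hi).mono (𝒢.mono hil)))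
  have hint (j) (hj : j ∈ Finset.Icc 1 n) (i) (hi : i ∈ Finset.Icc 1 n) :
      Integrable (fun ω ↦ K j ω * K i ω * Ψ j ω (Φ i ω)) μ := by
    obtain ⟨c, hc⟩ := hΨbdd j hj
    obtain ⟨d, hd⟩ := hΦbdd i hi
    refine ((hKL j hj).integrable_mul (hKL i hi)).mul_bdd (c := c * d)
      ((hB j hj i hi (le_max_left _ _) (le_max_right _ _)).mono (𝒢.le _)).aestronglyMeasurable
      (.of_forall fun ω ↦ ?_)
    exact (Ψ j ω).le_opNorm_of_le (hd ω) |>.trans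
      (mul_le_mul_of_nonneg_right (hc ω) ((norm_nonneg _).trans (hd ω)))
  have hfac (k) (hk : k ∈ Finset.Icc 1 n) (f : ℕ → ℝ) {Y : Ω → ℝ}
      (hY : StronglyMeasurable[𝒢 (k - 1)] Y) :
      ∫ ω, f (N k ω) * Y ω ∂μ = (∫ m, f m ∂poissonMeasure (lam k)) * ∫ ω, Y ω ∂μ := by
    rw [← hlaw k hk]
    exact integral_comp_mul_eq_of_indep (𝒢.le _) (hN k hk) (hindep k hk) f hY
  have hzero (k) (hk : k ∈ Finset.Icc 1 n) {Y : Ω → ℝ}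
      (hY : StronglyMeasurable[𝒢 (k - 1)] Y) : ∫ ω, K k ω * Y ω ∂μ = 0 := by
    rw [hfac k hk (fun m ↦ (m : ℝ) - lam k) hY, integral_sub_poissonMeasure, zero_mul]
  have hterm (j) (hj : j ∈ Finset.Icc 1 n) (i) (hi : i ∈ Finset.Icc 1 n) :
      ∫ ω, K j ω * K i ω * Ψ j ω (Φ i ω) ∂μ =
        if j = i then (lam j : ℝ) * ∫ ω, Ψ j ω (Φ j ω) ∂μ else 0 := by
    rcases lt_trichotomy j i with hji | rfl | hij
    · rw [if_neg hji.ne, ← hzero i hi ((hKm j hj (by lia)).mul (hB j hj i hi (by lia) le_rfl))]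
      congr with ω
      simp only [Pi.mul_apply]
      ring
    · rw [if_pos rfl, ← integral_sub_sq_poissonMeasure (lam j),
        ← hfac j hj (fun m ↦ ((m : ℝ) - lam j) ^ 2) (hB j hj j hj le_rfl le_rfl)]
      simp only [hK, sq]
    · rw [if_neg hij.ne', ← hzero j hj ((hKm i hi (by lia)).mul (hB j hj i hi le_rfl (by lia)))]
      congr with ω
      simp only [Pi.mul_apply]
      ring
  calc
    _ = ∫ ω, ∑ j ∈ Finset.Icc 1 n, ∑ i ∈ Finset.Icc 1 n, K j ω * K i ω * Ψ j ω (Φ i ω) ∂μ := by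
      congr with ω
      rw [_root_.sum_apply]
      refine Finset.sum_congr rfl fun j _ ↦ ?_
      rw [map_sum]
      refine Finset.sum_congr rfl fun i _ ↦ ?_
      simp only [_root_.smul_apply, map_smul, smul_eq_mul, hK]
      ring
    _ = ∑ j ∈ Finset.Icc 1 n, ∑ i ∈ Finset.Icc 1 n,
        if j = i then (lam j : ℝ) * ∫ ω, Ψ j ω (Φ j ω) ∂μ else 0 := by
      rw [integral_finsetSum _ fun j hj ↦ integrable_finsetSum _ fun i hi ↦ hint j hj i hi]
      refine Finset.sum_congr rfl fun j hj ↦ ?_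
      rw [integral_finsetSum _ fun i hi ↦ hint j hj i hi]
      exact Finset.sum_congr rfl fun i hi ↦ hterm j hj i hi
    _ = _ := by
      refine Finset.sum_congr rfl fun j hj ↦ ?_
      rw [Finset.sum_ite_eq, if_pos hj]
end
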